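/- For every k ≥ 4 there exist constants a, b ≥ 0 with (a−b)²/(k(a+(k−1)b)) < 1 (i.e., strictly below the Kesten–Stigum threshold) such that weak recovery is solvable in SSBM(n,k,a/n,b/n): there exist ε > 0 and estimators X̂_n with P(A(X, X̂_n(G)) ≥ 1/k + ε) → 1 as n → ∞. -/

import Mathlib

open Filter
open scoped Classical

abbrev VPair (n : ℕ) := {e : Fin n × Fin n // e.1 < e.2}

noncomputable def sbmMass {n k : ℕ} (p : Fin k → ℝ) (W : Matrix (Fin k) (Fin k) ℝ)
    (x : Fin n → Fin k) (g : VPair n → Bool) : ℝ :=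
  (∏ u, p (x u)) *
    ∏ e : VPair n,
      if g e then W (x e.1.1) (x e.1.2) else 1 - W (x e.1.1) (x e.1.2)

noncomputable def sbmProb {n k : ℕ} (p : Fin k → ℝ) (W : Matrix (Fin k) (Fin k) ℝ)
    (E : (Fin n → Fin k) → (VPair n → Bool) → Prop) : ℝ :=
  ∑ x : Fin n → Fin k, ∑ g : VPair n → Bool,
    if E x g then sbmMass p W x g else 0

noncomputable def agreement {n k : ℕ} (x y : Fin n → Fin k) : ℝ :=
  (Finset.univ : Finset (Equiv.Perm (Fin k))).sup' ⟨1, Finset.mem_univ 1⟩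
    fun π => ((Finset.univ.filter fun i : Fin n => x i = π (y i)).card : ℝ) / n


def ssbmW (k : ℕ) (A B : ℝ) : Matrix (Fin k) (Fin k) ℝ :=
  Matrix.of fun i j => if i = j then A else B

section Counting

variable {n k : ℕ}

lemma sum_sum_eq_two_mul_sum_vPair (f : Fin n → Fin n → ℝ) (hs : ∀ u v, f u v = f v u)
    (h0 : ∀ u, f u u = 0) :
    ∑ u, ∑ v, f u v = 2 * ∑ e : VPair n, f e.1.1 e.1.2 := by
  have h1 : ∑ e : VPair n, f e.1.1 e.1.2
      = ∑ u, ∑ v, if u < v then f u v else 0 := by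
    rw [← Fintype.sum_prod_type' (f := fun u v => if u < v then f u v else 0),
      ← Finset.sum_filter]
    exact (Finset.sum_subtype (Finset.univ.filter fun a : Fin n × Fin n => a.1 < a.2)
      (by simp) (fun a => f a.1 a.2)).symm
  have h2 : ∑ u, ∑ v, (if u < v then f u v else 0) = ∑ u, ∑ v, if v < u then f u v else 0 := by
    rw [Finset.sum_comm]
    exact Finset.sum_congr rfl fun u _ => Finset.sum_congr rfl fun v _ => by rw [hs]
  rw [two_mul, h1]
  nth_rewrite 2 [h2]
  rw [← Finset.sum_add_distrib]
  refine Finset.sum_congr rfl fun u _ => ?_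
  rw [← Finset.sum_add_distrib]
  refine Finset.sum_congr rfl fun v _ => ?_
  rcases lt_trichotomy u v with h | h | h
  · simp [h, h.not_gt]
  · subst h; simp [h0]
  · simp [h, h.not_gt]

/-- Number of coordinates of `z` equal to `a`. -/
noncomputable def classSize {α : Type*} (z : Fin n → α) (a : α) : ℕ :=
  (Finset.univ.filter fun u => z u = a).card

lemma classSize_eq_sum {α : Type*} (z : Fin n → α) (a : α) :
    (classSize z a : ℝ) = ∑ u, if z u = a then 1 else 0 := by
  simp [classSize]

lemma sum_classSize {α : Type*} [Fintype α] (z : Fin n → α) :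
    ∑ a, (classSize z a : ℝ) = n := by
  simp_rw [classSize_eq_sum]
  rw [Finset.sum_comm]
  simp

lemma sum_sum_ite_eq {α : Type*} [Fintype α] (z : Fin n → α) :
    ∑ u, ∑ v, (if z u = z v then (1 : ℝ) else 0) = ∑ a, (classSize z a : ℝ) ^ 2 := by
  have h : ∀ u v, (if z u = z v then (1 : ℝ) else 0)
      = ∑ a, (if z u = a then 1 else 0) * (if z v = a then 1 else 0) := by
    intro u v
    simp [eq_comm]
  simp_rw [h, classSize_eq_sum, sq, Finset.sum_mul_sum]
  conv_rhs => rw [Finset.sum_comm]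
  refine Finset.sum_congr rfl fun u _ => ?_
  rw [Finset.sum_comm]

/-- Number of pairs separated by the labelling `x`. -/
noncomputable def cutSize {α : Type*} (x : Fin n → α) : ℕ :=
  (Finset.univ.filter fun e : VPair n => x e.1.1 ≠ x e.1.2).card

lemma two_mul_cutSize {α : Type*} [Fintype α] (x : Fin n → α) :
    2 * (cutSize x : ℝ) = (n : ℝ) ^ 2 - ∑ a, (classSize x a : ℝ) ^ 2 := by
  have h := sum_sum_eq_two_mul_sum_vPair (fun u v => if x u ≠ x v then (1 : ℝ) else 0)
    (fun u v => by simp [eq_comm]) (by simp)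
  have h' : (cutSize x : ℝ) = ∑ e : VPair n, if x e.1.1 ≠ x e.1.2 then (1 : ℝ) else 0 := by
    rw [cutSize, Finset.card_filter]
    push_cast
    rfl
  rw [h', ← h, ← sum_sum_ite_eq]
  have : (n : ℝ) ^ 2 = ∑ u : Fin n, ∑ v : Fin n, (1 : ℝ) := by simp [sq]
  rw [this, ← Finset.sum_sub_distrib]
  refine Finset.sum_congr rfl fun u _ => ?_
  rw [← Finset.sum_sub_distrib]
  refine Finset.sum_congr rfl fun v _ => ?_
  by_cases hx : x u = x v <;> simp [hx]

/-- Number of pairs separated by both labellings. -/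
noncomputable def bothCutSize (x y : Fin n → Fin k) : ℕ :=
  (Finset.univ.filter fun e : VPair n => x e.1.1 ≠ x e.1.2 ∧ y e.1.1 ≠ y e.1.2).card

lemma two_mul_bothCutSize (x y : Fin n → Fin k) :
    2 * (bothCutSize x y : ℝ) = (n : ℝ) ^ 2 - ∑ a, (classSize x a : ℝ) ^ 2
      - ∑ a, (classSize y a : ℝ) ^ 2 + ∑ a, (classSize (fun u => (x u, y u)) a : ℝ) ^ 2 := by
  have h := sum_sum_eq_two_mul_sum_vPair
    (fun u v => if x u ≠ x v ∧ y u ≠ y v then (1 : ℝ) else 0)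
    (fun u v => by simp [eq_comm]) (by simp)
  have h' : (bothCutSize x y : ℝ)
      = ∑ e : VPair n, if x e.1.1 ≠ x e.1.2 ∧ y e.1.1 ≠ y e.1.2 then (1 : ℝ) else 0 := by
    simp [bothCutSize]
  rw [h', ← h, ← sum_sum_ite_eq, ← sum_sum_ite_eq, ← sum_sum_ite_eq]
  have : (n : ℝ) ^ 2 = ∑ u : Fin n, ∑ v : Fin n, (1 : ℝ) := by simp [sq]
  rw [this, ← Finset.sum_sub_distrib, ← Finset.sum_sub_distrib, ← Finset.sum_add_distrib]
  refine Finset.sum_congr rfl fun u _ => ?_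
  rw [← Finset.sum_sub_distrib, ← Finset.sum_sub_distrib, ← Finset.sum_add_distrib]
  refine Finset.sum_congr rfl fun v _ => ?_
  by_cases hx : x u = x v <;> by_cases hy : y u = y v <;> simp [hx, hy]

/-- All label classes have size within `δ n` of `n / k`. -/
def IsBalanced (δ : ℝ) (x : Fin n → Fin k) : Prop :=
  ∀ a, |(classSize x a : ℝ) - n / k| ≤ δ * n

lemma sum_sq_le_mul_sum {α : Type*} [Fintype α] (f : α → ℝ) (M : ℝ) (h0 : ∀ a, 0 ≤ f a)
    (hM : ∀ a, f a ≤ M) : ∑ a, f a ^ 2 ≤ M * ∑ a, f a := by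
  rw [Finset.mul_sum]
  exact Finset.sum_le_sum fun a _ => by nlinarith [h0 a, hM a]

lemma le_two_mul_cutSize {δ : ℝ} {x : Fin n → Fin k} (hx : IsBalanced δ x) :
    (n : ℝ) ^ 2 * (1 - 1 / k - δ) ≤ 2 * (cutSize x : ℝ) := by
  have h := sum_sq_le_mul_sum (fun a => (classSize x a : ℝ)) (n / k + δ * n)
    (fun a => by positivity) (fun a => by linarith [(abs_le.1 (hx a)).2])
  rw [sum_classSize] at h
  rw [two_mul_cutSize]
  have : (n / k + δ * n) * (n : ℝ) = (n : ℝ) ^ 2 * (1 / k + δ) := by ring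
  nlinarith

lemma div_le_sum_classSize_sq (hk : 0 < k) (x : Fin n → Fin k) :
    (n : ℝ) ^ 2 / k ≤ ∑ a, (classSize x a : ℝ) ^ 2 := by
  have h := sq_sum_le_card_mul_sum_sq (s := Finset.univ) (f := fun a => (classSize x a : ℝ))
  rw [sum_classSize] at h
  simp only [Finset.card_univ, Fintype.card_fin] at h
  rw [div_le_iff₀ (by positivity)]
  linarith

lemma two_mul_cutSize_le (hk : 0 < k) (x : Fin n → Fin k) :
    2 * (cutSize x : ℝ) ≤ (n : ℝ) ^ 2 * (1 - 1 / k) := by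
  have := div_le_sum_classSize_sq hk x
  rw [two_mul_cutSize]
  have : (n : ℝ) ^ 2 * (1 - 1 / k) = (n : ℝ) ^ 2 - (n : ℝ) ^ 2 / k := by ring
  linarith

lemma mul_entry_le_of_forall_perm {m : ℕ} (R : Fin (m + 2) → Fin (m + 2) → ℝ) (M : ℝ)
    (hM : ∀ π : Equiv.Perm (Fin (m + 2)), ∑ j, R (π j) j ≤ M) (i₀ j₀ : Fin (m + 2)) :
    (m + 2 : ℝ) * R i₀ j₀ + ∑ i, ∑ j, R i j - ∑ j, R i₀ j - ∑ i, R i j₀ ≤ (m + 1) * M := by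
  set e₁ := finSuccEquiv' i₀ with he₁
  set e₂ := finSuccEquiv' j₀ with he₂
  have h1 : e₁.symm none = i₀ := by simp [he₁]
  have h2 : e₂.symm none = j₀ := by simp [he₂]
  have h3 : e₂ j₀ = none := by simp [he₂]
  have key : ∀ s : Fin (m + 1), R i₀ j₀ + ∑ a, R (e₁.symm (some (a + s))) (e₂.symm (some a)) ≤ M := by
    intro s
    have := hM ((e₂.trans (Equiv.optionCongr (Equiv.addRight s))).trans e₁.symm)
    rw [← Equiv.sum_comp e₂.symm, Fintype.sum_option] at this
    simpa only [Equiv.trans_apply, Equiv.apply_symm_apply, Equiv.optionCongr_apply, Option.map_none,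
      Option.map_some, Equiv.coe_addRight, h1, h2, h3] using this
  have hsum := Finset.sum_le_sum fun s (_ : s ∈ Finset.univ) => key s
  rw [Finset.sum_add_distrib, Finset.sum_comm] at hsum
  have hre : ∀ a : Fin (m + 1), ∑ s, R (e₁.symm (some (a + s))) (e₂.symm (some a))
      = ∑ s, R (e₁.symm (some s)) (e₂.symm (some a)) := fun a =>
    Equiv.sum_comp (Equiv.addLeft a) fun s => R (e₁.symm (some s)) (e₂.symm (some a))
  simp_rw [hre] at hsum
  rw [Finset.sum_comm] at hsum
  simp only [Finset.sum_const, Finset.card_univ, Fintype.card_fin, nsmul_eq_mul] at hsum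
  have e1 : ∑ i, ∑ j, R i j = ∑ i, ∑ j, R (e₁.symm i) (e₂.symm j) := by
    rw [← Equiv.sum_comp e₁.symm]
    exact Finset.sum_congr rfl fun i _ => (Equiv.sum_comp e₂.symm _).symm
  rw [e1, ← Equiv.sum_comp e₂.symm, ← Equiv.sum_comp e₁.symm fun i => R i j₀]
  simp only [Fintype.sum_option, h1, h2, Finset.sum_add_distrib]
  push_cast at hsum
  linarith

lemma sum_classSize_pair_left (x y : Fin n → Fin k) (i : Fin k) :
    ∑ j, (classSize (fun u => (x u, y u)) (i, j) : ℝ) = classSize x i := by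
  simp_rw [classSize_eq_sum]
  rw [Finset.sum_comm]
  refine Finset.sum_congr rfl fun u _ => ?_
  by_cases h : x u = i <;> simp [h]

lemma sum_classSize_pair_right (x y : Fin n → Fin k) (j : Fin k) :
    ∑ i, (classSize (fun u => (x u, y u)) (i, j) : ℝ) = classSize y j := by
  simp_rw [classSize_eq_sum]
  rw [Finset.sum_comm]
  refine Finset.sum_congr rfl fun u _ => ?_
  by_cases h : y u = j <;> simp [h]

lemma classSize_pair_le (hn : 0 < n) (hk : 2 ≤ k) {δ ε : ℝ} (hε : 0 ≤ ε)
    {x y : Fin n → Fin k} (hx : IsBalanced δ x)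
    (hy : IsBalanced δ y) (hxy : agreement x y < 1 / k + ε) (a : Fin k × Fin k) :
    (classSize (fun u => (x u, y u)) a : ℝ) ≤ n * (1 / (k : ℝ) ^ 2 + ε + 2 * δ) := by
  obtain ⟨m, rfl⟩ := Nat.exists_eq_add_of_le' hk
  obtain ⟨i₀, j₀⟩ := a
  have hn' : (0 : ℝ) < n := by exact_mod_cast hn
  have hM : ∀ π : Equiv.Perm (Fin (m + 2)),
      ∑ j, (classSize (fun u => (x u, y u)) (π j, j) : ℝ) ≤ (1 / ((m + 2 : ℕ) : ℝ) + ε) * n := by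
    intro π
    have h1 := Finset.le_sup' (fun π : Equiv.Perm (Fin (m + 2)) =>
      ((Finset.univ.filter fun i : Fin n => x i = π (y i)).card : ℝ) / n) (Finset.mem_univ π)
    have h2 := (h1.trans_lt hxy).le
    rw [div_le_iff₀ hn'] at h2
    refine le_of_eq_of_le ?_ h2
    simp_rw [classSize_eq_sum]
    rw [Finset.sum_comm, Finset.card_filter]
    push_cast
    refine Finset.sum_congr rfl fun u _ => ?_
    by_cases h : x u = π (y u)
    · simp [h, eq_comm]
    · simp only [h, if_false, Prod.mk.injEq]
      refine Finset.sum_eq_zero fun j _ => if_neg ?_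
      rintro ⟨h3, rfl⟩
      exact h h3
  have key := mul_entry_le_of_forall_perm
    (fun i j => (classSize (fun u => (x u, y u)) (i, j) : ℝ)) _ hM i₀ j₀
  simp only [sum_classSize_pair_left, sum_classSize_pair_right, sum_classSize] at key
  have hx' := (abs_le.1 (hx i₀)).2
  have hy' := (abs_le.1 (hy j₀)).2
  set r := (classSize (fun u => (x u, y u)) (i₀, j₀) : ℝ)
  push_cast at *
  have hm : (0 : ℝ) < m + 2 := by positivity
  have e : (n : ℝ) / (m + 2) = n * (1 / (m + 2)) := by ring
  rw [e] at hx' hy'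
  set c : ℝ := 1 / (m + 2) with hc
  have hc1 : c * (m + 2) = 1 := by rw [hc]; field_simp
  have e2 : 1 / ((m : ℝ) + 2) ^ 2 = c * c := by rw [hc]; field_simp
  rw [e2]
  refine le_of_mul_le_mul_left ?_ hm
  have e3 : ((m : ℝ) + 2) * (n * (c * c + ε + 2 * δ))
      = n * c * (c * (m + 2)) + (m + 2) * (n * ε) + 2 * (m + 2) * n * δ := by ring
  rw [e3, hc1]
  have e4 : ((m : ℝ) + 1) * ((c + ε) * n) = (c * (m + 2)) * n - c * n + (m + 1) * (ε * n) := by ring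
  rw [e4, hc1] at key
  have hδ : 0 ≤ δ * n := (abs_nonneg _).trans (hx i₀)
  have : 0 ≤ ε * n := by positivity
  nlinarith [mul_nonneg (Nat.cast_nonneg (α := ℝ) m) hδ]

lemma two_mul_bothCutSize_le (hn : 0 < n) (hk : 2 ≤ k) {δ : ℝ} (hδ : 0 ≤ δ)
    {x y : Fin n → Fin k} (hx : IsBalanced δ x)
    (hy : IsBalanced δ y) (hxy : agreement x y < 1 / k + δ) :
    2 * (bothCutSize x y : ℝ) ≤ (n : ℝ) ^ 2 * ((1 - 1 / k) ^ 2 + 3 * δ) := by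
  rw [two_mul_bothCutSize]
  have h1 := div_le_sum_classSize_sq (by omega) x
  have h2 := div_le_sum_classSize_sq (by omega) y
  have h3 := sum_sq_le_mul_sum (fun a => (classSize (fun u => (x u, y u)) a : ℝ)) _
    (fun a => by positivity) (classSize_pair_le hn hk hδ hx hy hxy)
  rw [sum_classSize] at h3
  have e : (n : ℝ) ^ 2 * ((1 - 1 / k) ^ 2 + 3 * δ) = (n : ℝ) ^ 2 - (n : ℝ) ^ 2 / k - (n : ℝ) ^ 2 / k
    + n * (1 / (k : ℝ) ^ 2 + δ + 2 * δ) * n := by ring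
  linarith

end Counting

section Likelihood

variable {n k : ℕ}

/-- Conditional probability of the graph `g` given the labelling `x` when `a / n = 0` and
`b / n = p`. -/
noncomputable def lik (p : ℝ) (x : Fin n → Fin k) (g : VPair n → Bool) : ℝ :=
  ∏ e : VPair n,
    if g e then ssbmW k 0 p (x e.1.1) (x e.1.2) else 1 - ssbmW k 0 p (x e.1.1) (x e.1.2)

lemma sbmMass_eq_mul_lik (p : ℝ) (x : Fin n → Fin k) (g : VPair n → Bool) :
    sbmMass (fun _ : Fin k => 1 / (k : ℝ)) (ssbmW k 0 p) x g = (1 / (k : ℝ)) ^ n * lik p x g := by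
  simp [sbmMass, lik]

lemma sum_prod_bool {ι : Type*} [Fintype ι] [DecidableEq ι] (f : ι → Bool → ℝ) :
    ∑ g : ι → Bool, ∏ e, f e (g e) = ∏ e, (f e true + f e false) := by
  have h := Finset.prod_univ_sum (fun _ : ι => (Finset.univ : Finset Bool)) f
  rw [Fintype.piFinset_univ] at h
  simpa using h.symm

lemma sum_lik_mul_prod (p : ℝ) (x : Fin n → Fin k) (φ : VPair n → Bool → ℝ) :
    ∑ g, lik p x g * ∏ e, φ e (g e)
      = ∏ e : VPair n, if x e.1.1 = x e.1.2 then φ e false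
          else p * φ e true + (1 - p) * φ e false := by
  have h := sum_prod_bool fun (e : VPair n) (c : Bool) =>
    (if c then ssbmW k 0 p (x e.1.1) (x e.1.2) else 1 - ssbmW k 0 p (x e.1.1) (x e.1.2)) * φ e c
  calc ∑ g, lik p x g * ∏ e, φ e (g e)
      = ∑ g : VPair n → Bool, ∏ e : VPair n, (if g e then ssbmW k 0 p (x e.1.1) (x e.1.2)
          else 1 - ssbmW k 0 p (x e.1.1) (x e.1.2)) * φ e (g e) :=
        Finset.sum_congr rfl fun g _ => by rw [lik, ← Finset.prod_mul_distrib]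
    _ = _ := h
    _ = _ := Finset.prod_congr rfl fun e _ => by
        by_cases hx : x e.1.1 = x e.1.2 <;> simp [ssbmW, hx]

lemma sum_lik (p : ℝ) (x : Fin n → Fin k) : ∑ g, lik p x g = 1 := by
  simpa using sum_lik_mul_prod p x fun _ _ => 1

lemma lik_nonneg {p : ℝ} (h0 : 0 ≤ p) (h1 : p ≤ 1) (x : Fin n → Fin k) (g : VPair n → Bool) :
    0 ≤ lik p x g := by
  refine Finset.prod_nonneg fun e _ => ?_
  by_cases hx : x e.1.1 = x e.1.2 <;> by_cases hg : g e <;> simp [ssbmW, hx, hg] <;> linarith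

/-- `x` is a proper colouring of `g`. -/
def IsProper (x : Fin n → Fin k) (g : VPair n → Bool) : Prop :=
  ∀ e : VPair n, g e = true → x e.1.1 ≠ x e.1.2

/-- Number of edges of `g`. -/
noncomputable def edgeCount (g : VPair n → Bool) : ℕ :=
  (Finset.univ.filter fun e => g e = true).card

lemma pow_edgeCount (t : ℝ) (g : VPair n → Bool) :
    t ^ edgeCount g = ∏ e, if g e then t else 1 := by
  rw [Finset.prod_ite]
  simp [edgeCount]

lemma lik_of_isProper {p : ℝ} (h1 : p < 1) {x : Fin n → Fin k} {g : VPair n → Bool}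
    (h : IsProper x g) : lik p x g = (p / (1 - p)) ^ edgeCount g * (1 - p) ^ cutSize x := by
  have e : (1 - p) ^ cutSize x = ∏ e : VPair n, if x e.1.1 ≠ x e.1.2 then 1 - p else 1 := by
    rw [Finset.prod_ite]
    simp [cutSize]
  rw [pow_edgeCount, e, ← Finset.prod_mul_distrib]
  refine Finset.prod_congr rfl fun e _ => ?_
  have := h e
  have hp : 1 - p ≠ 0 := by linarith
  by_cases hx : x e.1.1 = x e.1.2 <;> by_cases hg : g e <;> simp [ssbmW, hx, hg] <;>
    first | (exact absurd hx (this hg)) | (field_simp)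

lemma lik_of_not_isProper {p : ℝ} {x : Fin n → Fin k} {g : VPair n → Bool}
    (h : ¬ IsProper x g) : lik p x g = 0 := by
  simp only [IsProper, not_forall, not_not] at h
  obtain ⟨e, hg, hx⟩ := h
  exact Finset.prod_eq_zero (Finset.mem_univ e) (by simp [ssbmW, hg, hx])

lemma sum_lik_mul_proper_mul_pow_le {p t : ℝ} (h0 : 0 ≤ p) (h1 : p ≤ 1) (ht : 0 ≤ t)
    (x y : Fin n → Fin k) :
    ∑ g, lik p x g * ((if IsProper y g then 1 else 0) * t ^ edgeCount g)
      ≤ Real.exp (p * (t * bothCutSize x y - cutSize x)) := by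
  have h : ∀ g : VPair n → Bool, (if IsProper y g then (1 : ℝ) else 0) * t ^ edgeCount g
      = ∏ e : VPair n, (fun (e : VPair n) (c : Bool) =>
          if c then (if y e.1.1 = y e.1.2 then 0 else t) else 1) e (g e) := by
    intro g
    by_cases hy : IsProper y g
    · rw [if_pos hy, one_mul, pow_edgeCount]
      refine Finset.prod_congr rfl fun e _ => ?_
      by_cases hg : g e
      · simp [hg, hy e hg]
      · simp [hg]
    · rw [if_neg hy, zero_mul]
      simp only [IsProper, not_forall, not_not] at hy
      obtain ⟨e, hg, hx⟩ := hy
      exact (Finset.prod_eq_zero (Finset.mem_univ e) (by simp [hg, hx])).symm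
  rw [(Finset.sum_congr rfl fun g _ => congrArg (lik p x g * ·) (h g)).trans
    (sum_lik_mul_prod p x fun e c => if c then (if y e.1.1 = y e.1.2 then 0 else t) else 1)]
  have e1 : (bothCutSize x y : ℝ)
      = ∑ e : VPair n, if x e.1.1 ≠ x e.1.2 ∧ y e.1.1 ≠ y e.1.2 then (1 : ℝ) else 0 := by
    rw [bothCutSize, Finset.card_filter]
    push_cast
    rfl
  have e2 : (cutSize x : ℝ) = ∑ e : VPair n, if x e.1.1 ≠ x e.1.2 then (1 : ℝ) else 0 := by
    rw [cutSize, Finset.card_filter]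
    push_cast
    rfl
  rw [e1, e2, Finset.mul_sum, ← Finset.sum_sub_distrib, Finset.mul_sum, Real.exp_sum]
  refine Finset.prod_le_prod (fun e _ => ?_) fun e _ => ?_
  · by_cases hx : x e.1.1 = x e.1.2 <;> by_cases hy : y e.1.1 = y e.1.2 <;> simp [hx, hy] <;>
      nlinarith
  · by_cases hx : x e.1.1 = x e.1.2 <;> by_cases hy : y e.1.1 = y e.1.2 <;> simp [hx, hy]
    · linarith [Real.add_one_le_exp (-p)]
    · linarith [Real.add_one_le_exp (p * (t - 1))]

lemma bothCutSize_self (x : Fin n → Fin k) : bothCutSize x x = cutSize x := by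
  simp [bothCutSize, cutSize]

lemma sum_lik_mul_pow_le {p t : ℝ} (h0 : 0 ≤ p) (h1 : p ≤ 1) (ht : 0 ≤ t)
    (x : Fin n → Fin k) :
    ∑ g, lik p x g * t ^ edgeCount g ≤ Real.exp (p * (t - 1) * cutSize x) := by
  have h := sum_lik_mul_proper_mul_pow_le h0 h1 ht x x
  rw [bothCutSize_self] at h
  refine le_of_eq_of_le (Finset.sum_congr rfl fun g _ => ?_)
    (h.trans_eq (congrArg Real.exp (by ring)))
  by_cases hx : IsProper x g
  · simp [hx]
  · simp [lik_of_not_isProper hx]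

end Likelihood

section Frozen

variable {n k : ℕ}

/-- Pairs joining `v` to a vertex with label in `S`. -/
noncomputable def edgeStar (x : Fin n → Fin k) (v : Fin n) (S : Finset (Fin k)) : Finset (VPair n) :=
  Finset.univ.filter fun e => e.1.1 = v ∧ x e.1.2 ∈ S ∨ e.1.2 = v ∧ x e.1.1 ∈ S

/-- Indicator that `g` has no edge in `E`. -/
noncomputable def noEdge (E : Finset (VPair n)) (g : VPair n → Bool) : ℝ :=
  if ∀ e ∈ E, g e = false then 1 else 0

/-- Indicator that `v` has a neighbour of every label other than its own. -/
noncomputable def frozen (x : Fin n → Fin k) (v : Fin n) (g : VPair n → Bool) : ℝ :=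
  ∏ j ∈ Finset.univ.erase (x v), (1 - noEdge (edgeStar x v {j}) g)

lemma card_star (x : Fin n → Fin k) (v : Fin n) (S : Finset (Fin k)) (hS : x v ∉ S) :
    (edgeStar x v S).card = ∑ j ∈ S, classSize x j := by
  have h := sum_sum_eq_two_mul_sum_vPair
    (fun a c => (if a = v ∧ x c ∈ S then (1 : ℝ) else 0) + if c = v ∧ x a ∈ S then 1 else 0)
    (fun a c => add_comm _ _) (fun a => by
      by_cases ha : a = v
      · subst ha; simp [hS]
      · simp [ha])
  have h' : ((edgeStar x v S).card : ℝ) = ∑ e : VPair n,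
      ((if e.1.1 = v ∧ x e.1.2 ∈ S then (1 : ℝ) else 0)
        + if e.1.2 = v ∧ x e.1.1 ∈ S then 1 else 0) := by
    rw [edgeStar, Finset.card_filter]
    push_cast
    refine Finset.sum_congr rfl fun e _ => ?_
    by_cases h1 : e.1.1 = v
    · have h2 : e.1.2 ≠ v := fun h2 => (e.2.trans_eq h2).ne h1
      simp [h1, h2]
    · simp [h1]
  have h3 : ∑ c : Fin n, (if x c ∈ S then (1 : ℝ) else 0) = ∑ j ∈ S, (classSize x j : ℝ) := by
    simp_rw [classSize_eq_sum]
    rw [Finset.sum_comm]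
    refine Finset.sum_congr rfl fun c _ => ?_
    convert! (Finset.sum_ite_eq S (x c) fun _ => (1 : ℝ)).symm
  have h4 : ∑ a : Fin n, ∑ c : Fin n, (if a = v ∧ x c ∈ S then (1 : ℝ) else 0)
      = ∑ j ∈ S, (classSize x j : ℝ) := by
    rw [← h3, Finset.sum_eq_single v (fun a _ ha => by simp [ha]) (by simp)]
    simp
  have h5 : ∑ a : Fin n, ∑ c : Fin n, (if c = v ∧ x a ∈ S then (1 : ℝ) else 0)
      = ∑ j ∈ S, (classSize x j : ℝ) := by
    rw [Finset.sum_comm]; exact h4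
  simp only [Finset.sum_add_distrib] at h h'
  have : ((edgeStar x v S).card : ℝ) = ∑ j ∈ S, (classSize x j : ℝ) := by linarith
  exact_mod_cast this

lemma ne_of_mem_star {x : Fin n → Fin k} {v : Fin n} {S : Finset (Fin k)} (hS : x v ∉ S)
    {e : VPair n} (he : e ∈ edgeStar x v S) : x e.1.1 ≠ x e.1.2 := by
  simp only [edgeStar, Finset.mem_filter, Finset.mem_univ, true_and] at he
  rcases he with ⟨rfl, h⟩ | ⟨rfl, h⟩
  · intro h'; rw [h'] at hS; exact hS h
  · intro h'; rw [← h'] at hS; exact hS h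

lemma sum_lik_mul_noEdge (p : ℝ) (x : Fin n → Fin k) (E : Finset (VPair n))
    (hE : ∀ e ∈ E, x e.1.1 ≠ x e.1.2) :
    ∑ g, lik p x g * noEdge E g = (1 - p) ^ E.card := by
  have h : ∀ g : VPair n → Bool, noEdge E g
      = ∏ e : VPair n, (fun (e : VPair n) (c : Bool) =>
          if e ∈ E ∧ c = true then (0 : ℝ) else 1) e (g e) := by
    intro g
    by_cases hg : ∀ e ∈ E, g e = false
    · rw [noEdge, if_pos hg, Finset.prod_eq_one]
      intro e _
      refine if_neg ?_
      rintro ⟨he, h⟩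
      simp [hg e he] at h
    · rw [noEdge, if_neg hg]
      push Not at hg
      obtain ⟨e, he, h⟩ := hg
      exact (Finset.prod_eq_zero (Finset.mem_univ e) (by simpa [he] using h)).symm
  rw [(Finset.sum_congr rfl fun g _ => congrArg (lik p x g * ·) (h g)).trans
    (sum_lik_mul_prod p x fun e c => if e ∈ E ∧ c = true then (0 : ℝ) else 1), ← Finset.prod_const, ← Finset.prod_subset (Finset.subset_univ E)]
  · exact Finset.prod_congr rfl fun e he => by simp [hE e he, he]
  · intro e _ he
    simp [he]

lemma noEdge_mul_noEdge (E F : Finset (VPair n)) (g : VPair n → Bool) :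
    noEdge E g * noEdge F g = noEdge (E ∪ F) g := by
  unfold noEdge
  by_cases h1 : ∀ e ∈ E, g e = false <;> by_cases h2 : ∀ e ∈ F, g e = false
  · rw [if_pos h1, if_pos h2, if_pos, one_mul]
    intro e he
    rcases Finset.mem_union.1 he with h | h
    exacts [h1 e h, h2 e h]
  · rw [if_neg h2, mul_zero, if_neg]
    exact fun h : ∀ e ∈ E ∪ F, g e = false => h2 fun e he => h e (Finset.mem_union_right _ he)
  · rw [if_neg h1, zero_mul, if_neg]
    exact fun h : ∀ e ∈ E ∪ F, g e = false => h1 fun e he => h e (Finset.mem_union_left _ he)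
  · rw [if_neg h1, zero_mul, if_neg]
    exact fun h : ∀ e ∈ E ∪ F, g e = false => h1 fun e he => h e (Finset.mem_union_left _ he)

lemma prod_noEdge_star (x : Fin n → Fin k) (v : Fin n) (S : Finset (Fin k)) (g : VPair n → Bool) :
    ∏ j ∈ S, noEdge (edgeStar x v {j}) g = noEdge (edgeStar x v S) g := by
  induction S using Finset.induction_on with
  | empty => simp [noEdge, edgeStar]
  | insert a S ha ih =>
    rw [Finset.prod_insert ha, ih, noEdge_mul_noEdge]
    congr 1
    ext e
    simp only [edgeStar, Finset.mem_union, Finset.mem_filter, Finset.mem_univ, true_and,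
      Finset.mem_insert, Finset.mem_singleton]
    tauto

lemma prod_one_sub_eq_sum_powerset {ι : Type*} (s : Finset ι) (f : ι → ℝ) :
    ∏ i ∈ s, (1 - f i) = ∑ t ∈ s.powerset, (-1) ^ t.card * ∏ i ∈ t, f i := by
  simp_rw [sub_eq_add_neg, Finset.prod_one_add, Finset.prod_neg]

lemma frozen_eq_sum (x : Fin n → Fin k) (v : Fin n) (g : VPair n → Bool) :
    frozen x v g
      = ∑ S ∈ (Finset.univ.erase (x v)).powerset, (-1) ^ S.card * noEdge (edgeStar x v S) g := by
  simp_rw [frozen, prod_one_sub_eq_sum_powerset, prod_noEdge_star]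

/-- Conditional probability that `v` is frozen. -/
noncomputable def frozenMean (p : ℝ) (x : Fin n → Fin k) (v : Fin n) : ℝ :=
  ∏ j ∈ Finset.univ.erase (x v), (1 - (1 - p) ^ classSize x j)

lemma frozenMean_eq_sum (p : ℝ) (x : Fin n → Fin k) (v : Fin n) :
    frozenMean p x v
      = ∑ S ∈ (Finset.univ.erase (x v)).powerset, (-1) ^ S.card * (1 - p) ^ (edgeStar x v S).card := by
  simp_rw [frozenMean, prod_one_sub_eq_sum_powerset]
  refine Finset.sum_congr rfl fun S hS => ?_
  rw [card_star, Finset.prod_pow_eq_pow_sum]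
  intro h
  simpa using Finset.mem_powerset.1 hS h

lemma notMem_of_mem_powerset_erase {a : Fin k} {S : Finset (Fin k)}
    (hS : S ∈ (Finset.univ.erase a).powerset) : a ∉ S := fun h => by
  simpa using Finset.mem_powerset.1 hS h

lemma sum_lik_mul_frozen (p : ℝ) (x : Fin n → Fin k) (v : Fin n) :
    ∑ g, lik p x g * frozen x v g = frozenMean p x v := by
  simp_rw [frozen_eq_sum, frozenMean_eq_sum, Finset.mul_sum]
  rw [Finset.sum_comm]
  refine Finset.sum_congr rfl fun S hS => ?_
  have hS' := notMem_of_mem_powerset_erase hS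
  rw [← sum_lik_mul_noEdge p x _ fun e he => ne_of_mem_star hS' he, Finset.mul_sum]
  exact Finset.sum_congr rfl fun g _ => by ring

lemma card_star_inter_le {x : Fin n → Fin k} {u v : Fin n} (huv : u ≠ v) (S T : Finset (Fin k)) :
    (edgeStar x u S ∩ edgeStar x v T).card ≤ 1 := by
  rw [Finset.card_le_one]
  rintro ⟨⟨a, c⟩, h⟩ he ⟨⟨a', c'⟩, h'⟩ he'
  simp only [edgeStar, Finset.mem_inter, Finset.mem_filter, Finset.mem_univ, true_and] at he he'
  simp only [Subtype.mk.injEq, Prod.mk.injEq]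
  simp only at h h'
  grind

lemma pow_card_union_star_le {p : ℝ} (h0 : 0 ≤ p) (h1 : p ≤ 1) {x : Fin n → Fin k} {u v : Fin n}
    (huv : u ≠ v) (S T : Finset (Fin k)) :
    |(1 - p) ^ (edgeStar x u S ∪ edgeStar x v T).card
      - (1 - p) ^ (edgeStar x u S).card * (1 - p) ^ (edgeStar x v T).card| ≤ p := by
  have h := Finset.card_union_add_card_inter (edgeStar x u S) (edgeStar x v T)
  rw [← pow_add, ← h]
  have h' := card_star_inter_le (x := x) huv S T
  have hpow : (0 : ℝ) ≤ (1 - p) ^ (edgeStar x u S ∪ edgeStar x v T).card :=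
    pow_nonneg (by linarith) _
  have hpow1 : (1 - p) ^ (edgeStar x u S ∪ edgeStar x v T).card ≤ 1 :=
    pow_le_one₀ (by linarith) (by linarith)
  interval_cases (edgeStar x u S ∩ edgeStar x v T).card
  · simpa using h0
  · rw [pow_add, pow_one, abs_of_nonneg] <;> nlinarith

lemma sum_lik_mul_frozen_mul_frozen_le {p : ℝ} (h0 : 0 ≤ p) (h1 : p ≤ 1) (x : Fin n → Fin k)
    {u v : Fin n} (huv : u ≠ v) :
    ∑ g, lik p x g * (frozen x u g * frozen x v g)
      ≤ frozenMean p x u * frozenMean p x v + 4 ^ k * p := by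
  have e1 : ∑ g, lik p x g * (frozen x u g * frozen x v g)
      = ∑ S ∈ (Finset.univ.erase (x u)).powerset, ∑ T ∈ (Finset.univ.erase (x v)).powerset,
        (-1) ^ S.card * (-1) ^ T.card * (1 - p) ^ (edgeStar x u S ∪ edgeStar x v T).card := by
    simp_rw [frozen_eq_sum, Finset.sum_mul_sum, Finset.mul_sum]
    rw [Finset.sum_comm]
    refine Finset.sum_congr rfl fun S hS => ?_
    rw [Finset.sum_comm]
    refine Finset.sum_congr rfl fun T hT => ?_
    have hS' := notMem_of_mem_powerset_erase hS
    have hT' := notMem_of_mem_powerset_erase hT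
    rw [← sum_lik_mul_noEdge p x (edgeStar x u S ∪ edgeStar x v T), Finset.mul_sum]
    · refine Finset.sum_congr rfl fun g _ => ?_
      rw [← noEdge_mul_noEdge]
      ring
    · intro e he
      rcases Finset.mem_union.1 he with h | h
      exacts [ne_of_mem_star hS' h, ne_of_mem_star hT' h]
  rw [e1, frozenMean_eq_sum, frozenMean_eq_sum, Finset.sum_mul_sum, ← sub_le_iff_le_add',
    ← Finset.sum_sub_distrib]
  simp_rw [← Finset.sum_sub_distrib]
  have hb : ∀ S ∈ (Finset.univ.erase (x u)).powerset, ∀ T ∈ (Finset.univ.erase (x v)).powerset,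
      (-1) ^ S.card * (-1) ^ T.card * (1 - p) ^ (edgeStar x u S ∪ edgeStar x v T).card
        - (-1) ^ S.card * (1 - p) ^ (edgeStar x u S).card
          * ((-1) ^ T.card * (1 - p) ^ (edgeStar x v T).card) ≤ p := by
    intro S _ T _
    have e : (-1 : ℝ) ^ S.card * (-1) ^ T.card * (1 - p) ^ (edgeStar x u S ∪ edgeStar x v T).card
        - (-1) ^ S.card * (1 - p) ^ (edgeStar x u S).card
          * ((-1) ^ T.card * (1 - p) ^ (edgeStar x v T).card)
        = (-1) ^ S.card * (-1) ^ T.card * ((1 - p) ^ (edgeStar x u S ∪ edgeStar x v T).card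
          - (1 - p) ^ (edgeStar x u S).card * (1 - p) ^ (edgeStar x v T).card) := by ring
    rw [e]
    refine (le_abs_self _).trans ?_
    rw [abs_mul, abs_mul, abs_pow, abs_pow]
    simpa using pow_card_union_star_le h0 h1 huv S T
  refine (Finset.sum_le_sum fun S hS => Finset.sum_le_card_nsmul _ _ _ (hb S hS)).trans ?_
  simp only [Finset.sum_const, Finset.card_powerset, nsmul_eq_mul, Nat.cast_pow, Nat.cast_ofNat]
  rw [← mul_assoc]
  refine mul_le_mul_of_nonneg_right ?_ h0
  have e4 : (4 : ℝ) ^ k = 2 ^ k * 2 ^ k := by rw [← mul_pow]; norm_num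
  have hc : ∀ a : Fin k, (2 : ℝ) ^ (Finset.univ.erase a).card ≤ 2 ^ k := fun a =>
    pow_le_pow_right₀ (by norm_num) ((Finset.card_le_univ _).trans_eq (Fintype.card_fin k))
  rw [e4]
  exact mul_le_mul (hc _) (hc _) (by positivity) (by positivity)

lemma frozen_mem_Icc (x : Fin n → Fin k) (v : Fin n) (g : VPair n → Bool) :
    0 ≤ frozen x v g ∧ frozen x v g ≤ 1 := by
  have h : ∀ j, 0 ≤ 1 - noEdge (edgeStar x v {j}) g ∧ 1 - noEdge (edgeStar x v {j}) g ≤ 1 := by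
    intro j
    unfold noEdge
    split_ifs <;> norm_num
  exact ⟨Finset.prod_nonneg fun j _ => (h j).1,
    Finset.prod_le_one (fun j _ => (h j).1) fun j _ => (h j).2⟩

lemma sum_lik_mul_sq_sum_frozen_le {p : ℝ} (h0 : 0 ≤ p) (h1 : p ≤ 1) (x : Fin n → Fin k) :
    ∑ g, lik p x g * (∑ v, frozen x v g - ∑ v, frozenMean p x v) ^ 2
      ≤ n + (n : ℝ) ^ 2 * (4 ^ k * p) := by
  set M := ∑ v, frozenMean p x v with hM
  have e1 : ∑ g, lik p x g * ∑ v, frozen x v g = M := by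
    simp_rw [Finset.mul_sum]
    rw [Finset.sum_comm]
    simp_rw [sum_lik_mul_frozen]
    rfl
  have e2 : ∑ g, lik p x g * (∑ v, frozen x v g) ^ 2
      ≤ M ^ 2 + (n + (n : ℝ) ^ 2 * (4 ^ k * p)) := by
    have e3 : ∑ g, lik p x g * (∑ v, frozen x v g) ^ 2
        = ∑ u, ∑ v, ∑ g, lik p x g * (frozen x u g * frozen x v g) := by
      simp_rw [sq, Finset.sum_mul_sum, Finset.mul_sum]
      rw [Finset.sum_comm]
      exact Finset.sum_congr rfl fun u _ => Finset.sum_comm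
    have hp : 0 ≤ 4 ^ k * p := by positivity
    have e4 : ∀ u v : Fin n, ∑ g, lik p x g * (frozen x u g * frozen x v g)
        ≤ frozenMean p x u * frozenMean p x v + (4 ^ k * p + if u = v then 1 else 0) := by
      intro u v
      by_cases huv : u = v
      · subst huv
        have h : ∑ g, lik p x g * (frozen x u g * frozen x u g) ≤ ∑ g, lik p x g := by
          refine Finset.sum_le_sum fun g _ => ?_
          have hf := frozen_mem_Icc x u g
          exact mul_le_of_le_one_right (lik_nonneg h0 h1 x g) (by nlinarith)
        rw [sum_lik] at h
        simp only [if_true]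
        nlinarith [mul_self_nonneg (frozenMean p x u)]
      · simpa [huv] using sum_lik_mul_frozen_mul_frozen_le h0 h1 x huv
    rw [e3]
    refine (Finset.sum_le_sum fun u _ => Finset.sum_le_sum fun v _ => e4 u v).trans_eq ?_
    simp only [Finset.sum_add_distrib, ← Finset.sum_mul_sum, Finset.sum_const, Finset.card_univ,
      Fintype.card_fin, nsmul_eq_mul, Finset.sum_ite_eq, Finset.mem_univ, if_true]
    rw [hM]
    ring
  have e5 : ∑ g, lik p x g * (∑ v, frozen x v g - M) ^ 2
      = ∑ g, lik p x g * (∑ v, frozen x v g) ^ 2 - 2 * M * ∑ g, lik p x g * ∑ v, frozen x v g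
        + M ^ 2 * ∑ g, lik p x g := by
    simp only [Finset.mul_sum (a := 2 * M), Finset.mul_sum (a := M ^ 2)]
    rw [← Finset.sum_sub_distrib, ← Finset.sum_add_distrib]
    exact Finset.sum_congr rfl fun g _ => by ring
  rw [e5, e1, sum_lik]
  linarith

lemma sum_lik_frozen_ge_le {p r : ℝ} (h0 : 0 ≤ p) (h1 : p ≤ 1) (hr : 0 < r) (x : Fin n → Fin k) :
    ∑ g, (if ∑ v, frozenMean p x v + r ≤ ∑ v, frozen x v g then lik p x g else 0)
      ≤ (n + (n : ℝ) ^ 2 * (4 ^ k * p)) / r ^ 2 := by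
  rw [le_div_iff₀ (by positivity), Finset.sum_mul]
  refine (Finset.sum_le_sum fun g _ => ?_).trans (sum_lik_mul_sq_sum_frozen_le h0 h1 x)
  have hl := lik_nonneg h0 h1 x g
  split_ifs with h
  · exact mul_le_mul_of_nonneg_left (by nlinarith) hl
  · rw [zero_mul]; positivity

end Frozen

section Balance

variable {n k : ℕ}

lemma sum_prod_apply {ι κ : Type*} [Fintype ι] [DecidableEq ι] [Fintype κ] (f : ι → κ → ℝ) :
    ∑ x : ι → κ, ∏ u, f u (x u) = ∏ u, ∑ c, f u c := by
  have h := Finset.prod_univ_sum (fun _ : ι => (Finset.univ : Finset κ)) f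
  rw [Fintype.piFinset_univ] at h
  exact h.symm

lemma sum_sq_sum_le (z : Fin k → ℝ) (h0 : ∑ c, z c = 0) (h1 : ∀ c, z c ^ 2 ≤ 1) :
    ∑ x : Fin n → Fin k, (∑ u, z (x u)) ^ 2 ≤ n * (k : ℝ) ^ n := by
  have hz : ∀ u v : Fin n, ∑ x : Fin n → Fin k, z (x u) * z (x v)
      ≤ if u = v then (k : ℝ) ^ n else 0 := by
    intro u v
    by_cases huv : u = v
    · subst huv
      rw [if_pos rfl]
      refine (Finset.sum_le_card_nsmul _ _ 1 fun x _ => ?_).trans ?_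
      · rw [← sq]; exact h1 _
      · simp
    · rw [if_neg huv]
      have h : ∀ x : Fin n → Fin k, z (x u) * z (x v)
          = ∏ w, (fun (w : Fin n) (c : Fin k) => if w = u ∨ w = v then z c else 1) w (x w) := by
        intro x
        rw [← Finset.prod_subset (Finset.subset_univ {u, v})]
        · rw [Finset.prod_pair huv]; simp
        · intro w _ hw
          simp only [Finset.mem_insert, Finset.mem_singleton] at hw
          exact if_neg hw
      rw [Finset.sum_congr rfl fun x _ => h x,
        sum_prod_apply (fun (w : Fin n) (c : Fin k) => if w = u ∨ w = v then z c else 1)]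
      exact (Finset.prod_eq_zero (Finset.mem_univ u) (by simpa using h0)).le
  simp_rw [sq, Finset.sum_mul_sum]
  rw [Finset.sum_comm]
  simp_rw [Finset.sum_comm (s := (Finset.univ : Finset (Fin n → Fin k)))]
  refine (Finset.sum_le_sum fun u _ => Finset.sum_le_sum fun v _ => hz u v).trans ?_
  simp

lemma sum_not_isBalanced_le (hk : 0 < k) (hn : 0 < n) {δ : ℝ} (hδ : 0 < δ) :
    ∑ x : Fin n → Fin k, (if ¬ IsBalanced δ x then (1 / (k : ℝ)) ^ n else 0)
      ≤ k / (δ ^ 2 * n) := by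
  have hk' : (0 : ℝ) < k := by exact_mod_cast hk
  have hn' : (0 : ℝ) < n := by exact_mod_cast hn
  have hvar : ∀ a : Fin k, ∑ x : Fin n → Fin k, ((classSize x a : ℝ) - n / k) ^ 2
      ≤ n * (k : ℝ) ^ n := by
    intro a
    have h := sum_sq_sum_le (n := n) (fun c : Fin k => (if c = a then (1 : ℝ) else 0) - 1 / k)
      (by simp [hk'.ne']) (fun c => by
        have : 1 / (k : ℝ) ≤ 1 := by
          rw [div_le_one hk']; exact_mod_cast hk
        have : 0 < 1 / (k : ℝ) := by positivity
        split_ifs <;> nlinarith)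
    refine le_of_eq_of_le (Finset.sum_congr rfl fun x _ => ?_) h
    rw [classSize_eq_sum, Finset.sum_sub_distrib]
    congr 2
    · exact Finset.sum_congr rfl fun u _ => by congr
    · simp [div_eq_mul_inv]
  have hpt : ∀ x : Fin n → Fin k, (if ¬ IsBalanced δ x then (1 / (k : ℝ)) ^ n else 0)
      ≤ (1 / (k : ℝ)) ^ n / (δ * n) ^ 2 * ∑ a, ((classSize x a : ℝ) - n / k) ^ 2 := by
    intro x
    have hs : 0 ≤ ∑ a, ((classSize x a : ℝ) - n / k) ^ 2 := Finset.sum_nonneg fun a _ => sq_nonneg _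
    split_ifs with h
    · positivity
    · simp only [IsBalanced, not_forall, not_le] at h
      obtain ⟨a, ha⟩ := h
      have h1 : ((classSize x a : ℝ) - n / k) ^ 2 ≤ ∑ a, ((classSize x a : ℝ) - n / k) ^ 2 :=
        Finset.single_le_sum (f := fun a => ((classSize x a : ℝ) - n / k) ^ 2)
          (fun a _ => sq_nonneg _) (Finset.mem_univ a)
      have h2 : (δ * n) ^ 2 ≤ ((classSize x a : ℝ) - n / k) ^ 2 := by
        rw [← sq_abs ((classSize x a : ℝ) - n / k)]
        exact pow_le_pow_left₀ (by positivity) ha.le 2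
      rw [div_mul_eq_mul_div, le_div_iff₀ (by positivity)]
      exact mul_le_mul_of_nonneg_left (h2.trans h1) (by positivity)
  refine (Finset.sum_le_sum fun x _ => hpt x).trans ?_
  rw [← Finset.mul_sum, Finset.sum_comm]
  have h3 := Finset.sum_le_card_nsmul Finset.univ
    (fun a : Fin k => ∑ x : Fin n → Fin k, ((classSize x a : ℝ) - n / k) ^ 2) _ fun a _ => hvar a
  simp only [Finset.card_univ, Fintype.card_fin, nsmul_eq_mul] at h3
  refine (mul_le_mul_of_nonneg_left h3 (by positivity)).trans_eq ?_
  rw [one_div, inv_pow]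
  field_simp

end Balance

section Entropy

variable {n k : ℕ}

/-- Sum of `w` over the line through `x` in direction `i`. -/
noncomputable def lineSum (w : (Fin n → Fin k) → ℝ) (i : Fin n) (x : Fin n → Fin k) : ℝ :=
  ∑ j, w (Function.update x i j)

/-- Sum of `w` over the labellings that agree with `x` on `s`. -/
noncomputable def cylinderSum (w : (Fin n → Fin k) → ℝ) (s : Finset (Fin n))
    (x : Fin n → Fin k) : ℝ :=
  ∑ y, if ∀ u ∈ s, y u = x u then w y else 0

lemma sum_lineSum_mul (w h : (Fin n → Fin k) → ℝ) (i : Fin n) :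
    ∑ x, lineSum w i x * h x = ∑ x, w x * lineSum h i x := by
  simp_rw [lineSum, Finset.sum_mul, Finset.mul_sum]
  rw [← Fintype.sum_prod_type', ← Fintype.sum_prod_type']
  have hinv : Function.Involutive fun a : (Fin n → Fin k) × Fin k =>
      (Function.update a.1 i a.2, a.1 i) := by
    rintro ⟨x, j⟩
    simp
  rw [← Equiv.sum_comp hinv.toPerm]
  refine Finset.sum_congr rfl fun a _ => ?_
  simp [Function.Involutive.toPerm]

lemma cylinderSum_update {w : (Fin n → Fin k) → ℝ} {s : Finset (Fin n)} {i : Fin n} (hi : i ∉ s)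
    (x : Fin n → Fin k) (j : Fin k) :
    cylinderSum w s (Function.update x i j) = cylinderSum w s x := by
  have h : ∀ y : Fin n → Fin k,
      (∀ u ∈ s, y u = Function.update x i j u) ↔ ∀ u ∈ s, y u = x u := fun y =>
    forall₂_congr fun u hu => by
      rw [Function.update_of_ne (ne_of_mem_of_not_mem hu hi)]
  simp only [cylinderSum, h]

lemma sum_cylinderSum_insert_update {w : (Fin n → Fin k) → ℝ} {s : Finset (Fin n)} {i : Fin n}
    (hi : i ∉ s) (x : Fin n → Fin k) :
    ∑ j, cylinderSum w (insert i s) (Function.update x i j) = cylinderSum w s x := by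
  simp only [cylinderSum]
  rw [Finset.sum_comm]
  refine Finset.sum_congr rfl fun y _ => ?_
  have h : ∀ j, (∀ u ∈ insert i s, y u = Function.update x i j u)
      ↔ (y i = j ∧ ∀ u ∈ s, y u = x u) := by
    intro j
    rw [Finset.forall_mem_insert, Function.update_self]
    exact and_congr_right fun _ => forall₂_congr fun u hu => by
      rw [Function.update_of_ne (ne_of_mem_of_not_mem hu hi)]
  simp only [h]
  by_cases hy : ∀ u ∈ s, y u = x u
  · simp only [and_iff_left hy, if_pos hy]
    simp
  · simp [hy]

lemma le_cylinderSum {w : (Fin n → Fin k) → ℝ} (hw : ∀ x, 0 ≤ w x) (s : Finset (Fin n))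
    (x : Fin n → Fin k) : w x ≤ cylinderSum w s x := by
  have h := Finset.single_le_sum (f := fun y => if ∀ u ∈ s, y u = x u then w y else 0)
    (fun y _ => by split_ifs <;> simp [hw]) (Finset.mem_univ x)
  simpa [cylinderSum] using h

lemma le_lineSum {w : (Fin n → Fin k) → ℝ} (hw : ∀ x, 0 ≤ w x) (i : Fin n)
    (x : Fin n → Fin k) : w x ≤ lineSum w i x := by
  have h := Finset.single_le_sum (f := fun j => w (Function.update x i j))
    (fun y _ => hw _) (Finset.mem_univ (x i))
  simpa [lineSum] using h

lemma sum_mul_log_cylinderSum_insert_le {w : (Fin n → Fin k) → ℝ} (hw : ∀ x, 0 ≤ w x)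
    {s : Finset (Fin n)} {i : Fin n} (hi : i ∉ s) :
    ∑ x, w x * (Real.log (cylinderSum w (insert i s) x)
        + (Real.log (lineSum w i x) - Real.log (w x)))
      ≤ ∑ x, w x * Real.log (cylinderSum w s x) := by
  set h : (Fin n → Fin k) → ℝ := fun x => cylinderSum w (insert i s) x / cylinderSum w s x with hh
  have hpt : ∀ x, w x * (Real.log (cylinderSum w (insert i s) x)
        + (Real.log (lineSum w i x) - Real.log (w x))) - w x * Real.log (cylinderSum w s x)
      ≤ lineSum w i x * h x - w x := by
    intro x
    have h1 := le_cylinderSum hw s x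
    have h2 := le_cylinderSum hw (insert i s) x
    have h3 := le_lineSum hw i x
    rcases (hw x).eq_or_lt with h0 | h0
    · rw [← h0] at h1 h2 h3 ⊢
      simp only [zero_mul, sub_zero, hh]
      positivity
    · have p1 := h0.trans_le h1
      have p2 := h0.trans_le h2
      have p3 := h0.trans_le h3
      have hlog := Real.log_le_sub_one_of_pos
        (show 0 < lineSum w i x * h x / w x by simp only [hh]; positivity)
      have e : Real.log (lineSum w i x * h x / w x) = Real.log (cylinderSum w (insert i s) x)
          + (Real.log (lineSum w i x) - Real.log (w x)) - Real.log (cylinderSum w s x) := by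
        rw [Real.log_div (by simp only [hh]; positivity) h0.ne',
          Real.log_mul p3.ne' (by simp only [hh]; positivity), hh, Real.log_div p2.ne' p1.ne']
        ring
      rw [e] at hlog
      have := mul_le_mul_of_nonneg_left hlog h0.le
      have e' : w x * (lineSum w i x * h x / w x - 1) = lineSum w i x * h x - w x := by
        field_simp
      rw [e', mul_sub] at this
      exact this
  have hsum := Finset.sum_le_sum fun x (_ : x ∈ Finset.univ) => hpt x
  rw [Finset.sum_sub_distrib, Finset.sum_sub_distrib, sum_lineSum_mul] at hsum
  have hline : ∀ x, w x * lineSum h i x ≤ w x := by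
    intro x
    refine mul_le_of_le_one_right (hw x) ?_
    simp only [lineSum, hh, cylinderSum_update hi]
    rw [← Finset.sum_div, sum_cylinderSum_insert_update hi]
    exact div_self_le_one _
  have := Finset.sum_le_sum fun x (_ : x ∈ Finset.univ) => hline x
  linarith

/-- The entropy of a distribution on `[k]^n` is at least the sum of the entropies of each
coordinate given all others, stated for unnormalised weights. -/
lemma sum_mul_log_add_le {w : (Fin n → Fin k) → ℝ} (hw : ∀ x, 0 ≤ w x) :
    ∑ x, w x * (Real.log (w x) + ∑ v, (Real.log (lineSum w v x) - Real.log (w x)))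
      ≤ (∑ x, w x) * Real.log (∑ x, w x) := by
  have key : ∀ s : Finset (Fin n), ∑ x, w x * (Real.log (cylinderSum w s x)
      + ∑ v ∈ s, (Real.log (lineSum w v x) - Real.log (w x)))
      ≤ (∑ x, w x) * Real.log (∑ x, w x) := by
    intro s
    induction s using Finset.induction_on with
    | empty => simp [cylinderSum, Finset.sum_mul]
    | insert i s hi ih =>
      refine le_trans ?_ ih
      have h := sum_mul_log_cylinderSum_insert_le hw hi
      have h' := add_le_add_left h (∑ x, w x * ∑ v ∈ s, (Real.log (lineSum w v x) - Real.log (w x)))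
      rw [← Finset.sum_add_distrib, ← Finset.sum_add_distrib] at h'
      refine (le_of_eq_of_le (Finset.sum_congr rfl fun x _ => ?_) h').trans_eq
        (Finset.sum_congr rfl fun x _ => ?_)
      · rw [Finset.sum_insert hi]
        ring
      · ring
  have hcyl : ∀ x, cylinderSum w Finset.univ x = w x := by
    intro x
    have h : ∀ y : Fin n → Fin k, (∀ u ∈ Finset.univ, y u = x u) ↔ y = x := fun y => by
      simp [funext_iff]
    simp only [cylinderSum, h]
    simp
  simpa only [hcyl] using key Finset.univ

lemma add_le_log_sum {w : (Fin n → Fin k) → ℝ} (hw : ∀ x, 0 ≤ w x) (hZ : 0 < ∑ x, w x)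
    {A : (Fin n → Fin k) → Prop} [DecidablePred A] {l B δ : ℝ} (hB : 0 ≤ B)
    (hl : ∀ x, 0 < w x → l ≤ Real.log (w x))
    (hA : ∀ x, A x → 0 < w x → B ≤ ∑ v, (Real.log (lineSum w v x) - Real.log (w x)))
    (hδ : (1 - δ) * ∑ x, w x ≤ ∑ x, if A x then w x else 0) :
    l + (1 - δ) * B ≤ Real.log (∑ x, w x) := by
  have h := sum_mul_log_add_le hw
  have hpt : ∀ x, l * w x + B * (if A x then w x else 0)
      ≤ w x * (Real.log (w x) + ∑ v, (Real.log (lineSum w v x) - Real.log (w x))) := by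
    intro x
    rcases (hw x).eq_or_lt with h0 | h0
    · simp [← h0]
    · have h1 := hl x h0
      have h2 : 0 ≤ ∑ v, (Real.log (lineSum w v x) - Real.log (w x)) :=
        Finset.sum_nonneg fun v _ => sub_nonneg.2 (Real.log_le_log h0 (le_lineSum hw v x))
      split_ifs with hAx
      · nlinarith [hA x hAx h0]
      · nlinarith
  have hsum := (Finset.sum_le_sum fun x (_ : x ∈ Finset.univ) => hpt x).trans h
  rw [Finset.sum_add_distrib, ← Finset.mul_sum, ← Finset.mul_sum] at hsum
  refine le_of_mul_le_mul_left ?_ hZ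
  nlinarith [mul_le_mul_of_nonneg_left hδ hB]

end Entropy

section Flip

variable {n k : ℕ}

lemma classSize_eq_sum_fin (x : Fin n → Fin k) (a : Fin k) :
    (classSize x a : ℝ) = ∑ u, if x u = a then 1 else 0 := by
  rw [classSize_eq_sum]
  congr!

lemma classSize_update (x : Fin n → Fin k) (v : Fin n) (j a : Fin k) :
    (classSize (Function.update x v j) a : ℝ)
      = classSize x a + (if a = j then 1 else 0) - if a = x v then 1 else 0 := by
  have h : ∀ u, (if Function.update x v j u = a then (1 : ℝ) else 0) = (if x u = a then 1 else 0)
      + if u = v then (if a = j then 1 else 0) - (if a = x v then 1 else 0) else 0 := by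
    intro u
    by_cases hu : u = v
    · subst hu
      simp only [Function.update_self, if_true, eq_comm (a := a)]
      ring
    · simp [hu]
  rw [classSize_eq_sum_fin, classSize_eq_sum_fin, Finset.sum_congr rfl fun u _ => h u,
    Finset.sum_add_distrib]
  simp only [Finset.sum_ite_eq', Finset.mem_univ, if_true]
  ring

lemma two_mul_cutSize_update (x : Fin n → Fin k) {v : Fin n} {j : Fin k} (hj : j ≠ x v) :
    2 * (cutSize (Function.update x v j) : ℝ)
      = 2 * cutSize x - 2 * classSize x j + 2 * classSize x (x v) - 2 := by
  rw [two_mul_cutSize, two_mul_cutSize]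
  have h : ∀ a, (classSize (Function.update x v j) a : ℝ) ^ 2 = (classSize x a : ℝ) ^ 2
      + (if a = j then 2 * (classSize x a : ℝ) + 1 else 0)
      - if a = x v then 2 * (classSize x a : ℝ) - 1 else 0 := by
    intro a
    rw [classSize_update]
    by_cases h1 : a = j
    · subst h1
      simp only [if_true, if_neg hj]
      ring
    · rw [if_neg h1, if_neg h1]
      by_cases h2 : a = x v
      · rw [if_pos h2, if_pos h2]
        ring
      · rw [if_neg h2, if_neg h2]
        ring
  rw [Finset.sum_congr rfl fun a _ => h a, Finset.sum_sub_distrib, Finset.sum_add_distrib]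
  simp only [Finset.sum_ite_eq', Finset.mem_univ, if_true]
  ring

lemma exists_isProper_update {x : Fin n → Fin k} {g : VPair n → Bool} (hx : IsProper x g)
    {v : Fin n} (hv : frozen x v g ≠ 1) : ∃ j ≠ x v, IsProper (Function.update x v j) g := by
  have h : ∃ j ∈ Finset.univ.erase (x v), 1 - noEdge (edgeStar x v {j}) g ≠ 1 := by
    by_contra! h
    exact hv (Finset.prod_eq_one h)
  obtain ⟨j, hj, hne⟩ := h
  refine ⟨j, Finset.ne_of_mem_erase hj, fun e he => ?_⟩
  have hE : ∀ e ∈ edgeStar x v {j}, g e = false := by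
    by_contra hE
    rw [noEdge, if_neg hE, sub_zero] at hne
    exact hne rfl
  have he' : e ∉ edgeStar x v {j} := fun h => by simp [hE e h] at he
  simp only [edgeStar, Finset.mem_filter, Finset.mem_univ, true_and, Finset.mem_singleton,
    not_or, not_and] at he'
  have hlt := e.2
  have hp := hx e he
  by_cases h1 : e.1.1 = v
  · have h2 : e.1.2 ≠ v := fun h2 => (hlt.trans_eq h2).ne h1
    rw [h1, Function.update_self, Function.update_of_ne h2]
    exact fun h => he'.1 h1 h.symm
  · by_cases h2 : e.1.2 = v
    · rw [h2, Function.update_self, Function.update_of_ne h1]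
      exact he'.2 h2
    · rwa [Function.update_of_ne h1, Function.update_of_ne h2]

lemma isProper_of_lik_pos {p : ℝ} {x : Fin n → Fin k} {g : VPair n → Bool} (h : 0 < lik p x g) :
    IsProper x g := by
  by_contra hx
  exact h.ne' (lik_of_not_isProper hx)

lemma log_lik {p : ℝ} (h0 : 0 < p) (h1 : p < 1) {x : Fin n → Fin k} {g : VPair n → Bool}
    (hx : IsProper x g) :
    Real.log (lik p x g)
      = edgeCount g * Real.log (p / (1 - p)) + cutSize x * Real.log (1 - p) := by
  have hq : 0 < 1 - p := by linarith
  rw [lik_of_isProper h1 hx, Real.log_mul (by positivity) (by positivity), Real.log_pow,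
    Real.log_pow]

lemma lik_pos {p : ℝ} (h0 : 0 < p) (h1 : p < 1) {x : Fin n → Fin k} {g : VPair n → Bool}
    (hx : IsProper x g) : 0 < lik p x g := by
  have hq : 0 < 1 - p := by linarith
  rw [lik_of_isProper h1 hx]
  positivity

lemma le_log_lineSum {p δ ρ : ℝ} (h0 : 0 < p) (h1 : p < 1) (hρ : 0 < ρ)
    (hρ' : ρ ≤ Real.exp (2 * δ * n * Real.log (1 - p))) {x : Fin n → Fin k} {g : VPair n → Bool}
    (hx : IsBalanced δ x) (hl : 0 < lik p x g) (v : Fin n) :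
    (1 - frozen x v g) * Real.log (1 + ρ)
      ≤ Real.log (lineSum (fun x => lik p x g) v x) - Real.log (lik p x g) := by
  have hw : ∀ x : Fin n → Fin k, 0 ≤ lik p x g := fun x => lik_nonneg h0.le h1.le x g
  have hp := isProper_of_lik_pos hl
  have hlog : 0 ≤ Real.log (1 + ρ) := Real.log_nonneg (by linarith)
  by_cases hf : frozen x v g = 1
  · rw [hf, sub_self, zero_mul, sub_nonneg]
    exact Real.log_le_log hl (le_lineSum (w := fun x => lik p x g) hw v x)
  obtain ⟨j, hj, hp'⟩ := exists_isProper_update hp hf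
  have hq : Real.log (1 - p) ≤ 0 := Real.log_nonpos (by linarith) (by linarith)
  have hcut : (cutSize (Function.update x v j) : ℝ) ≤ cutSize x + 2 * δ * n := by
    have := two_mul_cutSize_update x hj
    have := (abs_le.1 (hx j)).1
    have := (abs_le.1 (hx (x v))).2
    linarith
  have hflip : ρ * lik p x g ≤ lik p (Function.update x v j) g := by
    refine (mul_le_mul_of_nonneg_right hρ' hl.le).trans ?_
    rw [← Real.exp_log hl, ← Real.exp_log (lik_pos h0 h1 hp'), ← Real.exp_add, Real.exp_le_exp,
      log_lik h0 h1 hp, log_lik h0 h1 hp']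
    nlinarith
  have hline : (1 + ρ) * lik p x g ≤ lineSum (fun x => lik p x g) v x := by
    have h := Finset.sum_le_sum_of_subset_of_nonneg (Finset.subset_univ {x v, j})
      fun i _ _ => hw (Function.update x v i)
    rw [Finset.sum_pair hj.symm, Function.update_eq_self] at h
    rw [lineSum]
    linarith
  have h2 := Real.log_le_log (by positivity) hline
  rw [Real.log_mul (by positivity) hl.ne'] at h2
  have := (frozen_mem_Icc x v g).1
  nlinarith

/-- Lower bound on the partition function when the posterior concentrates on balanced labellings
with at least `β n` unfrozen vertices. -/
lemma le_log_sum_lik {p δ ρ β : ℝ} (hk : 0 < k) (h0 : 0 < p) (h1 : p < 1) (hρ : 0 < ρ)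
    (hρ' : ρ ≤ Real.exp (2 * δ * n * Real.log (1 - p))) (hβ : 0 ≤ β) {g : VPair n → Bool}
    (hZ : 0 < ∑ x : Fin n → Fin k, lik p x g)
    (hA : (1 - δ) * ∑ x : Fin n → Fin k, lik p x g ≤ ∑ x : Fin n → Fin k,
      if IsBalanced δ x ∧ β * n ≤ ∑ v, (1 - frozen x v g) then lik p x g else 0) :
    edgeCount g * Real.log (p / (1 - p)) + (n : ℝ) ^ 2 * (1 - 1 / k) / 2 * Real.log (1 - p)
      + (1 - δ) * (β * n * Real.log (1 + ρ)) ≤ Real.log (∑ x : Fin n → Fin k, lik p x g) := by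
  have hlog : 0 ≤ Real.log (1 + ρ) := Real.log_nonneg (by linarith)
  refine add_le_log_sum (fun x => lik_nonneg h0.le h1.le x g) hZ (by positivity) ?_ ?_ hA
  · intro x hl
    rw [log_lik h0 h1 (isProper_of_lik_pos hl)]
    have := two_mul_cutSize_le hk x
    have hq : Real.log (1 - p) ≤ 0 := Real.log_nonpos (by linarith) (by linarith)
    nlinarith
  · rintro x ⟨hx, hn⟩ hl
    refine (mul_le_mul_of_nonneg_right hn hlog).trans ?_
    rw [Finset.sum_mul]
    exact Finset.sum_le_sum fun v _ => le_log_lineSum h0 h1 hρ hρ' hx hl v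

end Flip

section Posterior

variable {α : Type*} [Fintype α]

lemma sum_mul_div_sum_le (w f : α → ℝ) (hf : ∀ x, 0 ≤ f x) :
    ∑ x, ∑ y, f x * w y / ∑ z, w z ≤ ∑ x, f x := by
  refine Finset.sum_le_sum fun x _ => ?_
  rw [← Finset.sum_div, ← Finset.mul_sum, mul_div_assoc]
  exact mul_le_of_le_one_right (hf x) (div_self_le_one _)

/-- A label maximising the posterior mass of `R · y` does at least as well as a label sampled
from the posterior. -/
lemma sum_sub_le_sum_of_forall_le {w : α → ℝ} (hw : ∀ x, 0 ≤ w x) (R : α → α → Prop) {y₀ : α}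
    (hy : ∀ y, (∑ x, if R x y then w x else 0) ≤ ∑ x, if R x y₀ then w x else 0) :
    ∑ x, w x - ∑ x, ∑ y, (if R x y then 0 else w x * w y / ∑ z, w z)
      ≤ ∑ x, if R x y₀ then w x else 0 := by
  set Z := ∑ z, w z with hZ
  have hZ0 : 0 ≤ Z := Finset.sum_nonneg fun x _ => hw x
  rcases hZ0.eq_or_lt with h0 | h0
  · rw [← h0]
    simp only [div_zero, ite_self, Finset.sum_const_zero, sub_zero]
    exact Finset.sum_nonneg fun x _ => by split_ifs <;> simp [hw]
  have h1 : Z = ∑ x, ∑ y, w x * w y / Z := by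
    simp_rw [← Finset.sum_div, ← Finset.mul_sum, ← hZ, ← Finset.sum_mul, ← hZ]
    field_simp
  have h2 : Z - ∑ x, ∑ y, (if R x y then 0 else w x * w y / Z)
      = ∑ y, w y / Z * ∑ x, if R x y then w x else 0 := by
    nth_rewrite 1 [h1]
    simp_rw [← Finset.sum_sub_distrib, Finset.mul_sum]
    rw [Finset.sum_comm]
    refine Finset.sum_congr rfl fun y _ => Finset.sum_congr rfl fun x _ => ?_
    split_ifs <;> ring
  rw [h2]
  refine (Finset.sum_le_sum fun y _ => mul_le_mul_of_nonneg_left (hy y)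
    (div_nonneg (hw y) hZ0)).trans_eq ?_
  rw [← Finset.sum_mul, ← Finset.sum_div, ← hZ, div_self h0.ne', one_mul]

lemma sum_sum_ite_le {w : α → ℝ} (hw : ∀ x, 0 ≤ w x) (R : α → α → Prop) (B : α → Prop) (P : Prop)
    [Decidable P] :
    ∑ x, ∑ y, (if R x y then 0 else w x * w y / ∑ z, w z)
      ≤ 2 * (∑ x, if ¬ B x then w x else 0) + (if P then 0 else ∑ z, w z)
        + ∑ x, ∑ y, if B x ∧ B y ∧ ¬ R x y ∧ P then w x * w y / ∑ z, w z else 0 := by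
  set Z := ∑ z, w z with hZ
  have hZ0 : 0 ≤ Z := Finset.sum_nonneg fun x _ => hw x
  set f : α → ℝ := fun x => if ¬ B x then w x else 0 with hf
  have hf0 : ∀ x, 0 ≤ f x := fun x => by simp only [hf]; split_ifs <;> simp [hw]
  have hpt : ∀ x y, (if R x y then 0 else w x * w y / Z) ≤ f x * w y / Z + f y * w x / Z
      + (if P then 0 else w x * w y / Z)
      + if B x ∧ B y ∧ ¬ R x y ∧ P then w x * w y / Z else 0 := by
    intro x y
    have h : 0 ≤ w x * w y / Z := div_nonneg (mul_nonneg (hw x) (hw y)) hZ0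
    have hx : 0 ≤ f x * w y / Z := div_nonneg (mul_nonneg (hf0 x) (hw y)) hZ0
    have hy : 0 ≤ f y * w x / Z := div_nonneg (mul_nonneg (hf0 y) (hw x)) hZ0
    by_cases hR : R x y
    · rw [if_pos hR]
      split_ifs <;> linarith
    rw [if_neg hR]
    by_cases hP : P
    · by_cases hBx : B x
      · by_cases hBy : B y
        · rw [if_pos (⟨hBx, hBy, hR, hP⟩ : B x ∧ B y ∧ ¬ R x y ∧ P), if_pos hP]
          linarith
        · have : f y = w y := if_pos hBy
          rw [this, mul_comm (w y)] at *
          split_ifs <;> linarith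
      · have : f x = w x := if_pos hBx
        rw [this] at *
        split_ifs <;> linarith
    · rw [if_neg hP]
      split_ifs <;> linarith
  refine (Finset.sum_le_sum fun x _ => Finset.sum_le_sum fun y _ => hpt x y).trans ?_
  simp only [Finset.sum_add_distrib]
  have h1 := sum_mul_div_sum_le w f hf0
  have h2 : ∑ x, ∑ y, f y * w x / Z ≤ ∑ x, f x := by
    rw [Finset.sum_comm]
    exact h1
  have h3 : ∑ x, ∑ y, (if P then 0 else w x * w y / Z) ≤ if P then 0 else Z := by
    split_ifs
    · simp
    · exact sum_mul_div_sum_le w w hw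
  linarith

end Posterior

section ErrorTerms

variable {n k : ℕ}

lemma sum_mul_le_of_isBalanced (hk : 0 < k) (hn : 0 < n) {δ η : ℝ} (hδ : 0 < δ) (hη : 0 ≤ η)
    {F : (Fin n → Fin k) → ℝ} (h1 : ∀ x, F x ≤ 1) (hF : ∀ x, IsBalanced δ x → F x ≤ η) :
    ∑ x, (1 / (k : ℝ)) ^ n * F x ≤ k / (δ ^ 2 * n) + η := by
  have hk' : (0 : ℝ) < k := by exact_mod_cast hk
  have hc : 0 < (1 / (k : ℝ)) ^ n := by positivity
  have hpt : ∀ x : Fin n → Fin k, (1 / (k : ℝ)) ^ n * F x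
      ≤ (if ¬ IsBalanced δ x then (1 / (k : ℝ)) ^ n else 0) + (1 / (k : ℝ)) ^ n * η := by
    intro x
    by_cases hx : IsBalanced δ x
    · rw [if_neg (not_not.2 hx), zero_add]
      exact mul_le_mul_of_nonneg_left (hF x hx) hc.le
    · rw [if_pos hx]
      nlinarith [h1 x]
  refine (Finset.sum_le_sum fun x _ => hpt x).trans ?_
  rw [Finset.sum_add_distrib]
  refine add_le_add (sum_not_isBalanced_le hk hn hδ) (le_of_eq ?_)
  simp only [Finset.sum_const, Finset.card_univ, Fintype.card_fun, Fintype.card_fin, nsmul_eq_mul,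
    Nat.cast_pow]
  rw [← mul_assoc, ← mul_pow, mul_one_div_cancel hk'.ne', one_pow, one_mul]

lemma neg_log_one_sub_le {δ : ℝ} (h1 : δ ≤ 1 / 2) :
    -Real.log (1 - δ) ≤ δ + 2 * δ ^ 2 := by
  have h : 0 < 1 - δ := by linarith
  have := Real.one_sub_inv_le_log_of_pos h
  have e : (1 - δ)⁻¹ - 1 ≤ δ + 2 * δ ^ 2 := by
    rw [sub_le_iff_le_add, inv_le_iff_one_le_mul₀ h]
    nlinarith [mul_nonneg (sq_nonneg δ) (show 0 ≤ 1 - 2 * δ by linarith)]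
  linarith

lemma sum_lik_edgeCount_lt_le (hn : 0 < n) {b δ : ℝ} (hb : 0 < b) (hbn : b < n) (hδ : 0 < δ)
    (hδ' : δ ≤ 1 / 2) (hm : 0 ≤ b * (1 - 1 / k) / 2 - (2 * b + 1) * δ)
    {x : Fin n → Fin k} (hx : IsBalanced δ x) :
    ∑ g, (if (edgeCount g : ℝ) < (b * (1 - 1 / k) / 2 - (2 * b + 1) * δ) * n
        then lik (b / n) x g else 0) ≤ Real.exp (-(δ ^ 2 * n)) := by
  have hn' : (0 : ℝ) < n := by exact_mod_cast hn
  set μ := b * (1 - 1 / k) / 2 - (2 * b + 1) * δ with hμ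
  have h0 : 0 ≤ b / n := by positivity
  have h1 : b / n ≤ 1 := by rw [div_le_one hn']; exact hbn.le
  have hs : 0 < 1 - δ := by linarith
  have hpt : ∀ g : VPair n → Bool, (if (edgeCount g : ℝ) < μ * n then lik (b / n) x g else 0)
      ≤ Real.exp (-(μ * n * Real.log (1 - δ))) * (lik (b / n) x g * (1 - δ) ^ edgeCount g) := by
    intro g
    have hl := lik_nonneg h0 h1 x g
    split_ifs with h
    · rw [mul_left_comm]
      refine le_mul_of_one_le_right hl ?_
      rw [← Real.exp_log hs, ← Real.exp_nat_mul, ← Real.exp_add, Real.one_le_exp_iff,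
        Real.exp_log hs]
      have : Real.log (1 - δ) ≤ 0 := Real.log_nonpos hs.le (by linarith)
      nlinarith
    · positivity
  refine (Finset.sum_le_sum fun g _ => hpt g).trans ?_
  rw [← Finset.mul_sum]
  refine (mul_le_mul_of_nonneg_left (sum_lik_mul_pow_le h0 h1 hs.le x) (Real.exp_pos _).le).trans ?_
  rw [← Real.exp_add, Real.exp_le_exp]
  have hcut := le_two_mul_cutSize hx
  have hlog := neg_log_one_sub_le hδ'
  have e1 : b / n * (1 - δ - 1) * cutSize x = -(b * δ / (2 * n) * (2 * cutSize x)) := by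
    field_simp
    ring
  have e2 : b * δ / (2 * n) * ((n : ℝ) ^ 2 * (1 - 1 / k - δ)) = b * δ * n * (1 - 1 / k - δ) / 2 := by
    field_simp
  have h2 := mul_le_mul_of_nonneg_left hcut (show 0 ≤ b * δ / (2 * n) by positivity)
  have h3 := mul_le_mul_of_nonneg_left hlog (show 0 ≤ μ * n by positivity)
  have hk0 : 0 ≤ 1 / (k : ℝ) := by positivity
  have h4 : μ * n * (δ + 2 * δ ^ 2) - b * δ * n * (1 - 1 / k - δ) / 2 ≤ -(δ ^ 2 * n) := by
    have e : μ * n * (δ + 2 * δ ^ 2) - b * δ * n * (1 - 1 / k - δ) / 2 + δ ^ 2 * n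
        = -(n * δ ^ 2) * (b / 2 + b / k + 2 * (2 * b + 1) * δ) := by
      rw [hμ]
      ring
    have : 0 ≤ n * δ ^ 2 * (b / 2 + b / k + 2 * (2 * b + 1) * δ) := by positivity
    linarith
  rw [e1]
  rw [e2] at h2
  linarith

lemma exp_le_one_sub_pow {b δ : ℝ} {a : ℕ} (hn : 0 < n) (hb : 0 < b) (hbn : b < n) (hδ : 0 ≤ δ)
    (hδ' : δ ≤ 1 / 2) (hlog : n * -Real.log (1 - b / n) ≤ b * (1 + δ))
    (hk : 0 < k) (ha : (a : ℝ) ≤ n / k + δ * n) :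
    Real.exp (-(b / k + 3 * b * δ)) ≤ (1 - b / n) ^ a := by
  have hn' : (0 : ℝ) < n := by exact_mod_cast hn
  have hk' : (1 : ℝ) ≤ k := by exact_mod_cast hk
  have hq : 0 < 1 - b / n := by rw [sub_pos, div_lt_one hn']; exact hbn
  rw [← Real.exp_log hq, ← Real.exp_nat_mul, Real.exp_le_exp]
  have hl : 0 ≤ -Real.log (1 - b / n) := by
    rw [neg_nonneg]
    exact Real.log_nonpos hq.le (by linarith [div_pos hb hn'])
  have h1 := mul_le_mul_of_nonneg_right ha hl
  have e : (n / k + δ * n) * -Real.log (1 - b / n)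
      = (1 / k + δ) * (n * -Real.log (1 - b / n)) := by ring
  have h2 := mul_le_mul_of_nonneg_left hlog (show 0 ≤ 1 / (k : ℝ) + δ by positivity)
  have hk1 : 1 / (k : ℝ) ≤ 1 := by rw [div_le_one (by linarith)]; exact hk'
  have h3 : (1 / k + δ) * (b * (1 + δ)) ≤ b / k + 3 * b * δ := by
    have e : (1 / k + δ) * (b * (1 + δ)) = b / k + b * δ * (1 / k + 1 + δ) := by ring
    have : b * δ * (1 / k + 1 + δ) ≤ b * δ * 3 :=
      mul_le_mul_of_nonneg_left (by linarith) (by positivity)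
    linarith
  linarith

lemma frozenMean_le {b δ : ℝ} (hn : 0 < n) (hb : 0 < b) (hbn : b < n) (hδ : 0 ≤ δ)
    (hδ' : δ ≤ 1 / 2) (hlog : n * -Real.log (1 - b / n) ≤ b * (1 + δ)) (hk : 0 < k)
    {x : Fin n → Fin k} (hx : IsBalanced δ x) (v : Fin n) :
    frozenMean (b / n) x v ≤ (1 - Real.exp (-(b / k + 3 * b * δ))) ^ (k - 1) := by
  have hn' : (0 : ℝ) < n := by exact_mod_cast hn
  have hq : 0 ≤ 1 - b / n := by rw [sub_nonneg, div_le_one hn']; exact hbn.le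
  have hq1 : 1 - b / n ≤ 1 := by linarith [div_pos hb hn']
  refine (Finset.prod_le_prod (fun j _ => sub_nonneg.2 (pow_le_one₀ hq hq1)) fun j _ =>
    sub_le_sub_left (exp_le_one_sub_pow hn hb hbn hδ hδ' hlog hk
      (by linarith [(abs_le.1 (hx j)).2])) 1).trans_eq ?_
  rw [Finset.prod_const, Finset.card_erase_of_mem (Finset.mem_univ _), Finset.card_univ,
    Fintype.card_fin]

/-- Lower bound for the limiting fraction of unfrozen vertices, with slack `δ`. -/
noncomputable def unfrozenRate (k : ℕ) (b δ : ℝ) : ℝ :=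
  1 - (1 - Real.exp (-(b / k + 3 * b * δ))) ^ (k - 1) - δ

lemma sum_lik_not_unfrozen_le {b δ : ℝ} (hn : 0 < n) (hb : 0 < b) (hbn : b < n) (hδ : 0 < δ)
    (hδ' : δ ≤ 1 / 2) (hlog : n * -Real.log (1 - b / n) ≤ b * (1 + δ)) (hk : 0 < k)
    {x : Fin n → Fin k} (hx : IsBalanced δ x) :
    ∑ g, (if unfrozenRate k b δ * n ≤ ∑ v, (1 - frozen x v g) then 0 else lik (b / n) x g)
      ≤ (1 + 4 ^ k * b) / (δ ^ 2 * n) := by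
  have hn' : (0 : ℝ) < n := by exact_mod_cast hn
  have h0 : 0 ≤ b / n := by positivity
  have h1 : b / n ≤ 1 := by rw [div_le_one hn']; exact hbn.le
  have h := sum_lik_frozen_ge_le h0 h1 (show 0 < δ * n by positivity) x
  have e : (n + (n : ℝ) ^ 2 * (4 ^ k * (b / n))) / (δ * n) ^ 2 = (1 + 4 ^ k * b) / (δ ^ 2 * n) := by
    field_simp
  rw [e] at h
  refine (Finset.sum_le_sum fun g _ => ?_).trans h
  have hl := lik_nonneg h0 h1 x g
  split_ifs with h2 h3 h3
  · exact hl
  · exact le_rfl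
  · exact le_rfl
  · exfalso
    refine h3 ?_
    have hM := Finset.sum_le_card_nsmul Finset.univ (fun v => frozenMean (b / n) x v) _
      fun v _ => frozenMean_le hn hb hbn hδ.le hδ' hlog hk hx v
    simp only [Finset.card_univ, Fintype.card_fin, nsmul_eq_mul] at hM
    rw [Finset.sum_sub_distrib] at h2
    simp only [Finset.sum_const, Finset.card_univ, Fintype.card_fin, nsmul_eq_mul, mul_one,
      unfrozenRate, not_le] at h2
    linarith

end ErrorTerms

section MainTerm

variable {n k : ℕ}

/-- Exponential rate by which the partition function exceeds its trivial lower bound. -/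
noncomputable def gainRate (k : ℕ) (b δ : ℝ) : ℝ :=
  (1 - δ) * (unfrozenRate k b δ * Real.log (1 + Real.exp (-(4 * b * δ))))

/-- Lower bound, in terms of `δ`, for the number of edges per vertex. -/
noncomputable def edgeRate (k : ℕ) (b δ : ℝ) : ℝ :=
  b * (1 - 1 / k) / 2 - (2 * b + 1) * δ

/-- Typical lower bound for the logarithm of the partition function at `g`. -/
noncomputable def logPartitionBound (k : ℕ) (b δ : ℝ) (g : VPair n → Bool) : ℝ :=
  edgeCount g * Real.log (b / n / (1 - b / n))
    + (n : ℝ) ^ 2 * (1 - 1 / k) / 2 * Real.log (1 - b / n) + n * gainRate k b δ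

lemma lik_div_sum_le {b δ : ℝ} (hn : 0 < n) (hb : 0 < b) (hbn : b < n) (hδ : 0 ≤ δ)
    (hδ' : δ ≤ 1 / 2) (hlog : n * -Real.log (1 - b / n) ≤ b * (1 + δ)) {y : Fin n → Fin k}
    (hy : IsBalanced δ y) {g : VPair n → Bool}
    (hZ : logPartitionBound k b δ g ≤ Real.log (∑ z : Fin n → Fin k, lik (b / n) z g)) :
    lik (b / n) y g / ∑ z : Fin n → Fin k, lik (b / n) z g
      ≤ Real.exp (n * (b * δ - gainRate k b δ)) * if IsProper y g then 1 else 0 := by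
  have hn' : (0 : ℝ) < n := by exact_mod_cast hn
  have h0 : 0 < b / n := by positivity
  have h1 : b / n < 1 := by rwa [div_lt_one hn']
  by_cases hp : IsProper y g
  swap
  · simp [lik_of_not_isProper hp, hp]
  have hl := lik_pos h0 h1 hp
  have hZ0 : 0 < ∑ z : Fin n → Fin k, lik (b / n) z g :=
    hl.trans_le (Finset.single_le_sum (f := fun z => lik (b / n) z g)
      (fun z _ => lik_nonneg h0.le h1.le z g) (Finset.mem_univ y))
  rw [if_pos hp, mul_one, ← Real.log_le_iff_le_exp (by positivity), Real.log_div hl.ne' hZ0.ne',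
    log_lik h0 h1 hp]
  rw [logPartitionBound] at hZ
  have hcut := le_two_mul_cutSize hy
  have hq : 0 ≤ -Real.log (1 - b / n) := by
    rw [neg_nonneg]
    exact Real.log_nonpos (by linarith) (by linarith)
  have h2 : ((n : ℝ) ^ 2 * (1 - 1 / k) / 2 - cutSize y) * -Real.log (1 - b / n)
      ≤ (n : ℝ) ^ 2 * δ / 2 * -Real.log (1 - b / n) :=
    mul_le_mul_of_nonneg_right (by linarith) hq
  have h3 : (n : ℝ) ^ 2 * δ / 2 * -Real.log (1 - b / n) ≤ n * (b * δ) := by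
    have e : (n : ℝ) ^ 2 * δ / 2 * -Real.log (1 - b / n)
        = n * δ / 2 * (n * -Real.log (1 - b / n)) := by ring
    rw [e]
    refine (mul_le_mul_of_nonneg_left hlog (by positivity)).trans ?_
    have : n * δ * b * (1 + δ) ≤ n * δ * b * 2 :=
      mul_le_mul_of_nonneg_left (by linarith) (by positivity)
    linarith
  linarith

lemma mul_bothCutSize_sub_cutSize_le (hn : 0 < n) (hk : 2 ≤ k) {δ : ℝ} (hδ : 0 ≤ δ)
    {x y : Fin n → Fin k} (hx : IsBalanced δ x) (hy : IsBalanced δ y)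
    (hxy : agreement x y < 1 / k + δ) :
    (k / (k - 1) : ℝ) * bothCutSize x y - cutSize x ≤ (n : ℝ) ^ 2 * (7 / 2 * δ) := by
  have hk' : (2 : ℝ) ≤ k := by exact_mod_cast hk
  have hk1 : (0 : ℝ) < k - 1 := by linarith
  have h1 := two_mul_bothCutSize_le hn hk hδ hx hy hxy
  have h2 := le_two_mul_cutSize hx
  have h3 := mul_le_mul_of_nonneg_left h1 (show (0 : ℝ) ≤ k / (k - 1) by positivity)
  have e : (k / (k - 1) : ℝ) * ((n : ℝ) ^ 2 * ((1 - 1 / k) ^ 2 + 3 * δ))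
      = (n : ℝ) ^ 2 * (1 - 1 / k + k / (k - 1) * (3 * δ)) := by
    field_simp
  have h4 : (k / (k - 1) : ℝ) ≤ 2 := by
    rw [div_le_iff₀ hk1]
    linarith
  have h5 : (n : ℝ) ^ 2 * (k / (k - 1) * (3 * δ)) ≤ (n : ℝ) ^ 2 * (2 * (3 * δ)) :=
    mul_le_mul_of_nonneg_left (mul_le_mul_of_nonneg_right h4 (by positivity)) (by positivity)
  rw [e] at h3
  linarith

lemma sum_lik_mul_lik_div_le {b δ : ℝ} (hn : 0 < n) (hk : 2 ≤ k) (hb : 0 < b) (hbn : b < n)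
    (hδ : 0 ≤ δ) (hδ' : δ ≤ 1 / 2) (hlog : n * -Real.log (1 - b / n) ≤ b * (1 + δ))
    {x y : Fin n → Fin k} (hx : IsBalanced δ x) (hy : IsBalanced δ y)
    (hxy : agreement x y < 1 / k + δ) :
    ∑ g, (if edgeRate k b δ * n ≤ edgeCount g ∧
        logPartitionBound k b δ g ≤ Real.log (∑ z : Fin n → Fin k, lik (b / n) z g)
      then lik (b / n) x g * lik (b / n) y g / ∑ z : Fin n → Fin k, lik (b / n) z g else 0)
    ≤ Real.exp (n * (9 / 2 * b * δ - gainRate k b δ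
        - edgeRate k b δ * Real.log (k / (k - 1)))) := by
  have hn' : (0 : ℝ) < n := by exact_mod_cast hn
  have hk' : (2 : ℝ) ≤ k := by exact_mod_cast hk
  have hk1 : (0 : ℝ) < k - 1 := by linarith
  have h0 : 0 ≤ b / n := by positivity
  have h1 : b / n ≤ 1 := by rw [div_le_one hn']; exact hbn.le
  set t : ℝ := k / (k - 1) with ht
  have ht0 : 0 < t := by positivity
  have ht1 : 1 ≤ t := by rw [ht, one_le_div hk1]; linarith
  have hlt : 0 ≤ Real.log t := Real.log_nonneg ht1
  set c := Real.exp (n * (b * δ - gainRate k b δ)) * Real.exp (-(edgeRate k b δ * n * Real.log t))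
    with hc
  have hpt : ∀ g, (if edgeRate k b δ * n ≤ edgeCount g ∧
        logPartitionBound k b δ g ≤ Real.log (∑ z : Fin n → Fin k, lik (b / n) z g)
      then lik (b / n) x g * lik (b / n) y g / ∑ z : Fin n → Fin k, lik (b / n) z g else 0)
      ≤ c * (lik (b / n) x g * ((if IsProper y g then 1 else 0) * t ^ edgeCount g)) := by
    intro g
    have hl := lik_nonneg h0 h1 x g
    have hi : (0 : ℝ) ≤ if IsProper y g then 1 else 0 := by split_ifs <;> norm_num
    by_cases h : edgeRate k b δ * n ≤ edgeCount g ∧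
        logPartitionBound k b δ g ≤ Real.log (∑ z : Fin n → Fin k, lik (b / n) z g)
    · have h2 := lik_div_sum_le hn hb hbn hδ hδ' hlog hy h.2
      have h3 : 1 ≤ Real.exp (-(edgeRate k b δ * n * Real.log t)) * t ^ edgeCount g := by
        rw [← Real.exp_log ht0, ← Real.exp_nat_mul, ← Real.exp_add, Real.one_le_exp_iff,
          Real.exp_log ht0]
        nlinarith [h.1]
      rw [if_pos h, mul_div_assoc, mul_left_comm]
      refine mul_le_mul_of_nonneg_left (h2.trans ?_) hl
      refine (le_mul_of_one_le_right (by positivity) h3).trans_eq ?_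
      rw [hc]
      ring
    · rw [if_neg h]
      positivity
  refine (Finset.sum_le_sum fun g _ => hpt g).trans ?_
  rw [← Finset.mul_sum]
  refine (mul_le_mul_of_nonneg_left (sum_lik_mul_proper_mul_pow_le h0 h1 ht0.le x y)
    (by positivity)).trans ?_
  rw [hc, ← Real.exp_add, ← Real.exp_add, Real.exp_le_exp]
  have h4 := mul_le_mul_of_nonneg_left (mul_bothCutSize_sub_cutSize_le hn hk hδ hx hy hxy) h0
  have e : b / n * ((n : ℝ) ^ 2 * (7 / 2 * δ)) = n * (7 / 2 * b * δ) := by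
    field_simp
  rw [e] at h4
  linarith

end MainTerm

section Recovery

variable {n k : ℕ}

lemma ite_logPartitionBound_le {b δ : ℝ} (hn : 0 < n) (hk : 0 < k) (hb : 0 < b) (hbn : b < n)
    (hδ : 0 < δ) (hδ' : δ ≤ 1 / 2) (hlog : n * -Real.log (1 - b / n) ≤ b * (1 + δ))
    (hu : 0 ≤ unfrozenRate k b δ) (g : VPair n → Bool) :
    (if logPartitionBound k b δ g ≤ Real.log (∑ z : Fin n → Fin k, lik (b / n) z g) then 0
      else ∑ z : Fin n → Fin k, lik (b / n) z g)
      ≤ 1 / δ * ∑ x : Fin n → Fin k,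
        if IsBalanced δ x ∧ unfrozenRate k b δ * n ≤ ∑ v, (1 - frozen x v g) then 0
          else lik (b / n) x g := by
  have hn' : (0 : ℝ) < n := by exact_mod_cast hn
  have h0 : 0 < b / n := by positivity
  have h1 : b / n < 1 := by rwa [div_lt_one hn']
  have hw : ∀ x : Fin n → Fin k, 0 ≤ lik (b / n) x g := fun x => lik_nonneg h0.le h1.le x g
  set A : (Fin n → Fin k) → Prop := fun x =>
    IsBalanced δ x ∧ unfrozenRate k b δ * n ≤ ∑ v, (1 - frozen x v g) with hA
  set Z := ∑ z : Fin n → Fin k, lik (b / n) z g with hZ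
  have hsum : Z = (∑ x, if A x then lik (b / n) x g else 0)
      + ∑ x, if A x then 0 else lik (b / n) x g := by
    rw [hZ, ← Finset.sum_add_distrib]
    exact Finset.sum_congr rfl fun x _ => by split_ifs <;> simp
  have hc : 0 ≤ ∑ x, if A x then 0 else lik (b / n) x g :=
    Finset.sum_nonneg fun x _ => by split_ifs <;> simp [hw]
  by_cases hL : logPartitionBound k b δ g ≤ Real.log Z
  · rw [if_pos hL]
    positivity
  rw [if_neg hL]
  have hZnn : 0 ≤ Z := Finset.sum_nonneg fun x _ => hw x
  rcases hZnn.eq_or_lt with hZ0 | hZ0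
  · rw [← hZ0]
    positivity
  rw [one_div, inv_mul_eq_div, le_div_iff₀ hδ]
  by_contra! hlt
  refine hL ?_
  have hρ : Real.exp (-(4 * b * δ)) ≤ Real.exp (2 * δ * n * Real.log (1 - b / n)) := by
    rw [Real.exp_le_exp]
    have h2 := mul_le_mul_of_nonneg_left hlog (show 0 ≤ 2 * δ by positivity)
    have h3 : 2 * δ * (b * (1 + δ)) ≤ 4 * b * δ := by
      have : 2 * δ * b * (1 + δ) ≤ 2 * δ * b * 2 :=
        mul_le_mul_of_nonneg_left (by linarith) (by positivity)
      linarith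
    linarith
  have h := le_log_sum_lik (g := g) hk h0 h1 (Real.exp_pos _) hρ hu hZ0
    (by
      have : (1 - δ) * Z ≤ ∑ x, if A x then lik (b / n) x g else 0 := by linarith
      exact this)
  rw [logPartitionBound, gainRate]
  refine le_of_eq_of_le ?_ h
  ring

lemma mul_sum_sum_comm {α β : Type*} [Fintype α] [Fintype β] (c : ℝ) (f : α → β → ℝ) :
    c * ∑ g, ∑ x, f x g = ∑ x, c * ∑ g, f x g := by
  rw [Finset.sum_comm, Finset.mul_sum]

/-- Upper bound for the probability that the maximum posterior agreement estimator fails. -/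
noncomputable def errorBound (k n : ℕ) (b δ : ℝ) : ℝ :=
  2 * (k / (δ ^ 2 * n)) + (k / (δ ^ 2 * n) + Real.exp (-(δ ^ 2 * n)))
    + 1 / δ * (k / (δ ^ 2 * n) + (1 + 4 ^ k * b) / (δ ^ 2 * n))
    + k ^ n * Real.exp (n * (9 / 2 * b * δ - gainRate k b δ
        - edgeRate k b δ * Real.log (k / (k - 1))))

lemma sum_lik_ite_le_one {p : ℝ} (h0 : 0 ≤ p) (h1 : p ≤ 1) (x : Fin n → Fin k)
    (P : (VPair n → Bool) → Prop) [DecidablePred P] :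
    ∑ g, (if P g then lik p x g else 0) ≤ 1 := by
  rw [← sum_lik p x]
  refine Finset.sum_le_sum fun g _ => ?_
  split_ifs
  · exact le_rfl
  · exact lik_nonneg h0 h1 x g

lemma one_sub_errorBound_le {b δ : ℝ} (hn : 0 < n) (hk : 2 ≤ k) (hb : 0 < b) (hbn : b < n)
    (hδ : 0 < δ) (hδ' : δ ≤ 1 / 2) (hlog : n * -Real.log (1 - b / n) ≤ b * (1 + δ))
    (hu : 0 ≤ unfrozenRate k b δ) (he : 0 ≤ edgeRate k b δ)
    {est : (VPair n → Bool) → Fin n → Fin k}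
    (hest : ∀ g y, (∑ x : Fin n → Fin k, if 1 / (k : ℝ) + δ ≤ agreement x y
        then lik (b / n) x g else 0)
      ≤ ∑ x : Fin n → Fin k, if 1 / (k : ℝ) + δ ≤ agreement x (est g)
        then lik (b / n) x g else 0) :
    1 - errorBound k n b δ ≤ sbmProb (fun _ : Fin k => 1 / (k : ℝ)) (ssbmW k 0 (b / n))
      fun x g => 1 / (k : ℝ) + δ ≤ agreement x (est g) := by
  have hn' : (0 : ℝ) < n := by exact_mod_cast hn
  have hk0 : 0 < k := by omega
  have hk' : (0 : ℝ) < k := by exact_mod_cast hk0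
  have h0 : 0 ≤ b / n := by positivity
  have h1 : b / n ≤ 1 := by rw [div_le_one hn']; exact hbn.le
  have hw : ∀ (g : VPair n → Bool) (x : Fin n → Fin k), 0 ≤ lik (b / n) x g :=
    fun g x => lik_nonneg h0 h1 x g
  set R : (Fin n → Fin k) → (Fin n → Fin k) → Prop := fun x y => 1 / (k : ℝ) + δ ≤ agreement x y
    with hR
  set c : ℝ := (1 / (k : ℝ)) ^ n with hc
  have hc0 : 0 < c := by positivity
  have hck : c * (k : ℝ) ^ n = 1 := by
    rw [hc, ← mul_pow, one_div_mul_cancel hk'.ne', one_pow]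
  have hprob : sbmProb (fun _ : Fin k => 1 / (k : ℝ)) (ssbmW k 0 (b / n))
      (fun x g => R x (est g)) = c * ∑ g, ∑ x, if R x (est g) then lik (b / n) x g else 0 := by
    rw [mul_sum_sum_comm, sbmProb]
    refine Finset.sum_congr rfl fun x _ => ?_
    rw [Finset.mul_sum]
    refine Finset.sum_congr rfl fun g _ => ?_
    rw [sbmMass_eq_mul_lik, mul_ite, mul_zero]
  have hmass : c * ∑ g, ∑ x : Fin n → Fin k, lik (b / n) x g = 1 := by
    rw [mul_sum_sum_comm]
    simp [sum_lik, mul_comm _ c, hck]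
  set P : (VPair n → Bool) → Prop := fun g => edgeRate k b δ * n ≤ edgeCount g ∧
    logPartitionBound k b δ g ≤ Real.log (∑ z : Fin n → Fin k, lik (b / n) z g) with hP
  set T1 : (VPair n → Bool) → ℝ := fun g =>
    ∑ x : Fin n → Fin k, if ¬ IsBalanced δ x then lik (b / n) x g else 0 with hT1
  set T2 : (VPair n → Bool) → ℝ := fun g => ∑ x : Fin n → Fin k,
    if (edgeCount g : ℝ) < edgeRate k b δ * n then lik (b / n) x g else 0 with hT2
  set T3 : (VPair n → Bool) → ℝ := fun g => ∑ x : Fin n → Fin k,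
    if IsBalanced δ x ∧ unfrozenRate k b δ * n ≤ ∑ v, (1 - frozen x v g) then 0
      else lik (b / n) x g with hT3
  set T4 : (VPair n → Bool) → ℝ := fun g => ∑ x : Fin n → Fin k, ∑ y : Fin n → Fin k,
    if IsBalanced δ x ∧ IsBalanced δ y ∧ ¬ R x y ∧ P g
      then lik (b / n) x g * lik (b / n) y g / ∑ z : Fin n → Fin k, lik (b / n) z g else 0 with hT4
  have hpt : ∀ g, ∑ x : Fin n → Fin k, lik (b / n) x g - (2 * T1 g + (T2 g + 1 / δ * T3 g) + T4 g)
      ≤ ∑ x, if R x (est g) then lik (b / n) x g else 0 := by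
    intro g
    have e1 := sum_sub_le_sum_of_forall_le (hw g) R (hest g)
    have e2 : ∑ x, ∑ y, (if R x y then 0
        else lik (b / n) x g * lik (b / n) y g / ∑ z : Fin n → Fin k, lik (b / n) z g)
        ≤ 2 * T1 g + (if P g then 0 else ∑ z : Fin n → Fin k, lik (b / n) z g) + T4 g :=
      sum_sum_ite_le (hw g) R (IsBalanced δ) (P g)
    have e3 : (if P g then 0 else ∑ z : Fin n → Fin k, lik (b / n) z g)
        ≤ T2 g + 1 / δ * T3 g := by
      have e4 := ite_logPartitionBound_le hn hk0 hb hbn hδ hδ' hlog hu g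
      have hT2g : T2 g = if (edgeCount g : ℝ) < edgeRate k b δ * n
          then ∑ z : Fin n → Fin k, lik (b / n) z g else 0 := by
        simp only [hT2]
        split_ifs <;> simp
      have hZ0 : 0 ≤ ∑ z : Fin n → Fin k, lik (b / n) z g := Finset.sum_nonneg fun z _ => hw g z
      rw [hT2g]
      by_cases hm : (edgeCount g : ℝ) < edgeRate k b δ * n
      · rw [if_pos hm, if_neg fun h : P g => hm.not_ge h.1]
        have : 0 ≤ T3 g := Finset.sum_nonneg fun x _ => by split_ifs <;> simp [hw]
        have : 0 ≤ 1 / δ * T3 g := by positivity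
        linarith
      · rw [if_neg hm, zero_add]
        refine le_trans (le_of_eq ?_) e4
        simp only [hP, not_lt.1 hm, true_and]
    linarith
  have b1 : c * ∑ g, T1 g ≤ k / (δ ^ 2 * n) := by
    rw [mul_sum_sum_comm]
    have := sum_mul_le_of_isBalanced hk0 hn hδ le_rfl
      (F := fun x => ∑ g, if ¬ IsBalanced δ x then lik (b / n) x g else 0)
      (fun x => sum_lik_ite_le_one h0 h1 x _) (fun x hx => by simp [hx])
    simpa [hc] using this
  have b2 : c * ∑ g, T2 g ≤ k / (δ ^ 2 * n) + Real.exp (-(δ ^ 2 * n)) := by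
    rw [mul_sum_sum_comm]
    exact sum_mul_le_of_isBalanced hk0 hn hδ (Real.exp_pos _).le
      (fun x => sum_lik_ite_le_one h0 h1 x _)
      fun x hx => sum_lik_edgeCount_lt_le hn hb hbn hδ hδ' he hx
  have b3 : c * ∑ g, T3 g ≤ k / (δ ^ 2 * n) + (1 + 4 ^ k * b) / (δ ^ 2 * n) := by
    rw [mul_sum_sum_comm]
    refine sum_mul_le_of_isBalanced hk0 hn hδ (by positivity) (fun x => ?_) fun x hx => ?_
    · simp_rw [← ite_not (p := _ ∧ _)]
      exact sum_lik_ite_le_one h0 h1 x _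
    · simp only [hx, true_and]
      exact sum_lik_not_unfrozen_le hn hb hbn hδ hδ' hlog hk0 hx
  have b4 : c * ∑ g, T4 g ≤ k ^ n * Real.exp (n * (9 / 2 * b * δ - gainRate k b δ
        - edgeRate k b δ * Real.log (k / (k - 1)))) := by
    set r := Real.exp (n * (9 / 2 * b * δ - gainRate k b δ
        - edgeRate k b δ * Real.log (k / (k - 1)))) with hr
    have hr0 : 0 < r := Real.exp_pos _
    have hxy : ∀ x y : Fin n → Fin k, ∑ g, (if IsBalanced δ x ∧ IsBalanced δ y ∧ ¬ R x y ∧ P g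
      then lik (b / n) x g * lik (b / n) y g / ∑ z : Fin n → Fin k, lik (b / n) z g else 0)
        ≤ r := by
      intro x y
      by_cases h : IsBalanced δ x ∧ IsBalanced δ y ∧ ¬ R x y
      · obtain ⟨hx, hy, hxy⟩ := h
        simp only [hx, hy, hxy, not_false_eq_true, true_and]
        exact sum_lik_mul_lik_div_le hn hk hb hbn hδ.le hδ' hlog hx hy (not_le.1 hxy)
      · refine le_of_eq_of_le (Finset.sum_eq_zero fun g _ => if_neg ?_) hr0.le
        exact fun h' => h ⟨h'.1, h'.2.1, h'.2.2.1⟩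
    rw [mul_sum_sum_comm]
    have hx : ∀ x : Fin n → Fin k, c * ∑ g, ∑ y, (if IsBalanced δ x ∧ IsBalanced δ y ∧ ¬ R x y ∧ P g
      then lik (b / n) x g * lik (b / n) y g / ∑ z : Fin n → Fin k, lik (b / n) z g else 0)
        ≤ r := by
      intro x
      rw [mul_sum_sum_comm]
      refine (Finset.sum_le_card_nsmul _ _ (c * r) fun y _ =>
        mul_le_mul_of_nonneg_left (hxy x y) hc0.le).trans_eq ?_
      simp only [Finset.card_univ, Fintype.card_fun, Fintype.card_fin, nsmul_eq_mul, Nat.cast_pow]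
      rw [← mul_assoc, mul_comm _ c, hck, one_mul]
    refine (Finset.sum_le_card_nsmul _ _ r fun x _ => hx x).trans_eq ?_
    simp
  rw [hprob]
  have hfin := mul_le_mul_of_nonneg_left (Finset.sum_le_sum fun g (_ : g ∈ Finset.univ) => hpt g) hc0.le
  refine le_trans ?_ hfin
  have hsum : c * ∑ g, (∑ x : Fin n → Fin k, lik (b / n) x g
      - (2 * T1 g + (T2 g + 1 / δ * T3 g) + T4 g))
      = c * (∑ g, ∑ x : Fin n → Fin k, lik (b / n) x g) - (2 * (c * ∑ g, T1 g)
        + (c * ∑ g, T2 g + 1 / δ * (c * ∑ g, T3 g)) + c * ∑ g, T4 g) := by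
    rw [Finset.sum_sub_distrib, Finset.sum_add_distrib, Finset.sum_add_distrib,
      Finset.sum_add_distrib, ← Finset.mul_sum, ← Finset.mul_sum]
    ring
  have b3' := mul_le_mul_of_nonneg_left b3 (show 0 ≤ 1 / δ by positivity)
  rw [hsum, hmass, errorBound]
  linarith

end Recovery

section Threshold

lemma log_lt_sq_div {k : ℝ} (hk : 5 ≤ k) : Real.log k < (k - 1) ^ 2 / (2 * k - 1) := by
  have h1 : Real.log k = 2 * Real.log 2 + Real.log (5 / 4) + Real.log (k / 5) := by
    have e : k = 2 * 2 * (5 / 4) * (k / 5) := by ring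
    nth_rewrite 1 [e]
    rw [Real.log_mul (by norm_num) (by positivity), Real.log_mul (by norm_num) (by norm_num),
      Real.log_mul (by norm_num) (by norm_num)]
    ring
  have h2 := Real.log_two_lt_d9
  have h3 := Real.log_le_sub_one_of_pos (show (0 : ℝ) < 5 / 4 by norm_num)
  have h4 := Real.log_le_sub_one_of_pos (show 0 < k / 5 by positivity)
  refine lt_of_le_of_lt (b := k / 5 + 0.64) (by linarith) ?_
  rw [lt_div_iff₀ (by linarith)]
  nlinarith

/-- The first moment condition with the entropy gain from unfrozen vertices holds at the
Kesten–Stigum threshold `b = k (k - 1)`. -/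
lemma log_lt_at_kestenStigum {k : ℕ} (hk : 4 ≤ k) :
    Real.log k < (1 - (1 - Real.exp (-((k : ℝ) - 1))) ^ (k - 1)) * Real.log 2
      + ((k : ℝ) - 1) ^ 2 / 2 * Real.log (k / (k - 1)) := by
  rcases hk.eq_or_lt with rfl | hk5
  · have h2 := Real.log_two_lt_d9
    have h2' := Real.log_two_gt_d9
    have h4 : Real.log ((4 : ℕ) : ℝ) = 2 * Real.log 2 := by
      rw [← Real.log_rpow (by norm_num)]
      norm_num
    have h43 := Real.sum_range_le_log_div (x := 1 / 7) (by norm_num) (by norm_num) 2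
    norm_num [Finset.sum_range_succ] at h43
    have he : 0.049 ≤ Real.exp (-3) := by
      have h := Real.exp_one_lt_d9
      rw [Real.exp_neg, le_inv_comm₀ (by norm_num) (Real.exp_pos _)]
      have e : Real.exp 3 = Real.exp 1 ^ 3 := by rw [← Real.exp_nat_mul]; norm_num
      rw [e]
      refine (pow_le_pow_left₀ (Real.exp_pos _).le h.le 3).trans (by norm_num)
    have he1 : Real.exp (-3) ≤ 1 := Real.exp_le_one_iff.2 (by norm_num)
    have h5 : (1 - Real.exp (-3)) ^ 3 ≤ 0.951 ^ 3 :=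
      pow_le_pow_left₀ (by linarith) (by linarith) 3
    rw [h4]
    norm_num
    norm_num at h5
    nlinarith
  · have hk' : (5 : ℝ) ≤ k := by exact_mod_cast hk5
    have h1 := log_lt_sq_div hk'
    have h2 := Real.le_log_one_add_of_nonneg (x := 1 / ((k : ℝ) - 1))
      (one_div_nonneg.2 (by linarith))
    have hk1 : (0 : ℝ) < k - 1 := by linarith
    have h2k : (0 : ℝ) < 2 * k - 1 := by linarith
    have e1 : 1 + 1 / ((k : ℝ) - 1) = k / (k - 1) := by
      field_simp
      ring
    have e2 : 2 * (1 / ((k : ℝ) - 1)) / (1 / (k - 1) + 2) = 2 / (2 * k - 1) := by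
      have : 1 / ((k : ℝ) - 1) + 2 = (2 * k - 1) / (k - 1) := by
        field_simp
        ring
      rw [this]
      field_simp
    rw [e1, e2] at h2
    have h3 := mul_le_mul_of_nonneg_left h2 (show 0 ≤ ((k : ℝ) - 1) ^ 2 / 2 by positivity)
    have e3 : ((k : ℝ) - 1) ^ 2 / 2 * (2 / (2 * k - 1)) = (k - 1) ^ 2 / (2 * k - 1) := by
      field_simp
    rw [e3] at h3
    have h4 : (1 - Real.exp (-((k : ℝ) - 1))) ^ (k - 1) ≤ 1 :=
      pow_le_one₀ (sub_nonneg.2 (Real.exp_le_one_iff.2 (by linarith)))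
        (by linarith [Real.exp_pos (-((k : ℝ) - 1))])
    have h5 : 0 ≤ (1 - (1 - Real.exp (-((k : ℝ) - 1))) ^ (k - 1)) * Real.log 2 :=
      mul_nonneg (by linarith) (Real.log_nonneg (by norm_num))
    linarith

lemma exists_below_kestenStigum {k : ℕ} (hk : 4 ≤ k) :
    ∃ b δ : ℝ, 0 < b ∧ b < k * (k - 1) ∧ 0 < δ ∧ δ ≤ 1 / 2 ∧ 0 ≤ unfrozenRate k b δ ∧
      0 ≤ edgeRate k b δ ∧
      Real.log k + (9 / 2 * b * δ - gainRate k b δ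
        - edgeRate k b δ * Real.log (k / (k - 1))) < 0 := by
  have hk' : (4 : ℝ) ≤ k := by exact_mod_cast hk
  have hk1 : (0 : ℝ) < k - 1 := by linarith
  have hk0 : (k : ℝ) ≠ 0 := by linarith
  set b : ℝ → ℝ := fun s => k * (k - 1) - s with hb
  have hb0 : b 0 = k * (k - 1) := by simp [hb]
  have hbk : b 0 / k = k - 1 := by rw [hb0]; field_simp
  have hbc : Continuous b := by fun_prop
  have hu : Continuous fun s => unfrozenRate k (b s) s := by unfold unfrozenRate; fun_prop
  have he : Continuous fun s => edgeRate k (b s) s := by unfold edgeRate; fun_prop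
  have hg : Continuous fun s => gainRate k (b s) s := by
    unfold gainRate
    refine Continuous.mul (by fun_prop) (hu.mul (Continuous.log (by fun_prop) fun s => ?_))
    positivity
  have hΦ : Continuous fun s => Real.log k + (9 / 2 * b s * s - gainRate k (b s) s
      - edgeRate k (b s) s * Real.log (k / (k - 1))) := by fun_prop
  have e1 : ∀ᶠ s in nhds (0 : ℝ), 0 < b s :=
    hbc.continuousAt.eventually_const_lt (by rw [hb0]; positivity)
  have e2 : ∀ᶠ s in nhds (0 : ℝ), 0 < unfrozenRate k (b s) s := by
    refine hu.continuousAt.eventually_const_lt ?_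
    simp only [unfrozenRate, hbk, mul_zero, add_zero, sub_zero, sub_pos]
    refine pow_lt_one₀ (sub_nonneg.2 (Real.exp_le_one_iff.2 (by linarith)))
      (by linarith [Real.exp_pos (-((k : ℝ) - 1))]) (by omega)
  have e3 : ∀ᶠ s in nhds (0 : ℝ), 0 < edgeRate k (b s) s := by
    refine he.continuousAt.eventually_const_lt ?_
    simp only [edgeRate, hb0, mul_zero, sub_zero]
    have : 0 < 1 - 1 / (k : ℝ) := by
      rw [sub_pos, div_lt_one (by linarith)]
      linarith
    positivity
  have e4 : ∀ᶠ s in nhds (0 : ℝ), Real.log k + (9 / 2 * b s * s - gainRate k (b s) s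
      - edgeRate k (b s) s * Real.log (k / (k - 1))) < 0 := by
    refine hΦ.continuousAt.eventually_lt_const ?_
    have h := log_lt_at_kestenStigum hk
    have hE : edgeRate k (b 0) 0 = ((k : ℝ) - 1) ^ 2 / 2 := by
      rw [edgeRate, hb0]
      field_simp
      ring
    have hG : gainRate k (b 0) 0
        = (1 - (1 - Real.exp (-((k : ℝ) - 1))) ^ (k - 1)) * Real.log 2 := by
      simp only [gainRate, unfrozenRate, hbk, mul_zero, add_zero, sub_zero, neg_zero, Real.exp_zero,
        one_mul]
      norm_num
    show Real.log k + (9 / 2 * b 0 * 0 - gainRate k (b 0) 0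
      - edgeRate k (b 0) 0 * Real.log (k / (k - 1))) < 0
    rw [hE, hG]
    linarith
  have e5 : ∀ᶠ s in nhds (0 : ℝ), s < 1 / 2 := eventually_lt_nhds (by norm_num)
  have hall := ((e1.and (e2.and (e3.and (e4.and e5)))).filter_mono
    (nhdsWithin_le_nhds (s := Set.Ioi 0))).and self_mem_nhdsWithin
  obtain ⟨s, ⟨h1, h2, h3, h4, h5⟩, hs⟩ := hall.exists
  have hs' : 0 < s := hs
  exact ⟨b s, s, h1, by simp only [hb]; linarith, hs', h5.le, h2.le, h3.le, h4⟩

end Threshold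

section Limit

lemma tendsto_errorBound {k : ℕ} (hk : 0 < k) {b δ : ℝ}
    (hΦ : Real.log k + (9 / 2 * b * δ - gainRate k b δ
        - edgeRate k b δ * Real.log (k / (k - 1))) < 0) (hδ : 0 < δ) :
    Tendsto (fun n : ℕ => errorBound k n b δ) atTop (nhds 0) := by
  have hk' : (0 : ℝ) < k := by exact_mod_cast hk
  have hlin : ∀ c : ℝ, 0 < c → Tendsto (fun n : ℕ => c * (n : ℝ)) atTop atTop := fun c hc =>
    tendsto_natCast_atTop_atTop.const_mul_atTop hc
  have hδ2 : 0 < δ ^ 2 := by positivity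
  have hdiv : ∀ c : ℝ, Tendsto (fun n : ℕ => c / (δ ^ 2 * n)) atTop (nhds 0) := fun c =>
    (hlin _ hδ2).const_div_atTop c
  have hexp : Tendsto (fun n : ℕ => Real.exp (-(δ ^ 2 * n))) atTop (nhds 0) :=
    Real.tendsto_exp_neg_atTop_nhds_zero.comp (hlin _ hδ2)
  have hmain := Real.tendsto_exp_neg_atTop_nhds_zero.comp (hlin _ (neg_pos.2 hΦ))
  have h := ((((hdiv k).const_mul 2).add ((hdiv k).add hexp)).add
    (((hdiv k).add (hdiv (1 + 4 ^ k * b))).const_mul (1 / δ))).add hmain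
  simp only [mul_zero, add_zero] at h
  refine h.congr fun n => ?_
  simp only [errorBound, Function.comp_apply]
  congr 1
  rw [← Real.exp_log hk', ← Real.exp_nat_mul, ← Real.exp_add, Real.exp_log hk']
  congr 1
  ring

lemma sbmProb_le_one {n k : ℕ} (hk : 0 < k) {p : ℝ} (h0 : 0 ≤ p) (h1 : p ≤ 1)
    (E : (Fin n → Fin k) → (VPair n → Bool) → Prop) :
    sbmProb (fun _ : Fin k => 1 / (k : ℝ)) (ssbmW k 0 p) E ≤ 1 := by
  have hk' : (0 : ℝ) < k := by exact_mod_cast hk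
  have h : ∑ x : Fin n → Fin k, (1 / (k : ℝ)) ^ n * ∑ g, lik p x g = 1 := by
    simp [sum_lik, hk'.ne']
  refine le_of_le_of_eq (Finset.sum_le_sum fun x _ => ?_) h
  rw [Finset.mul_sum]
  refine Finset.sum_le_sum fun g _ => ?_
  have hl := lik_nonneg h0 h1 x g
  rw [sbmMass_eq_mul_lik]
  split_ifs
  · exact le_rfl
  · positivity

lemma eventually_mul_neg_log_le {b δ : ℝ} (hb : 0 < b) (hδ : 0 < δ) :
    ∀ᶠ n : ℕ in atTop, b < n ∧ n * -Real.log (1 - b / n) ≤ b * (1 + δ) := by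
  filter_upwards [tendsto_natCast_atTop_atTop.eventually_gt_atTop (b * (1 + δ) / δ)] with n hn
  rw [div_lt_iff₀ hδ] at hn
  have hbn : b < n := by
    by_contra! h
    nlinarith
  have hn0 : (0 : ℝ) < n := hb.trans hbn
  refine ⟨hbn, ?_⟩
  have hq : 0 < 1 - b / n := by rwa [sub_pos, div_lt_one hn0]
  have h1 : -Real.log (1 - b / n) ≤ b / (n - b) := by
    have h := Real.one_sub_inv_le_log_of_pos hq
    have e : (1 - b / n)⁻¹ - 1 = b / (n - b) := by
      have : (n : ℝ) - b ≠ 0 := by linarith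
      have e : 1 - b / n = (n - b) / n := by field_simp
      rw [e, inv_div]
      field_simp
      ring
    linarith
  refine (mul_le_mul_of_nonneg_left h1 hn0.le).trans ?_
  rw [mul_div_assoc', div_le_iff₀ (by linarith)]
  nlinarith

end Limit

/-- For every `k ≥ 4` one can solve weak recovery strictly below the Kesten–Stigum
threshold: there are `a, b ≥ 0` with `(a−b)²/(k(a+(k−1)b)) < 1` for which weak
recovery is solvable in `SSBM(n,k,a/n,b/n)`. -/
theorem crossing_KS_at_four_communities (k : ℕ) (hk : 4 ≤ k) :
    ∃ a b : ℝ, 0 ≤ a ∧ 0 ≤ b ∧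
      (a - b) ^ 2 / ((k : ℝ) * (a + ((k : ℝ) - 1) * b)) < 1 ∧
      ∃ ε > (0 : ℝ), ∃ est : (n : ℕ) → (VPair n → Bool) → (Fin n → Fin k),
        Tendsto
          (fun n : ℕ =>
            sbmProb (fun _ : Fin k => 1 / (k : ℝ)) (ssbmW k (a / n) (b / n))
              fun x g => 1 / (k : ℝ) + ε ≤ agreement x (est n g))
          atTop (nhds 1) := by
  have hk0 : 0 < k := by omega
  have hk' : (4 : ℝ) ≤ k := by exact_mod_cast hk
  obtain ⟨b, δ, hb, hbk, hδ, hδ', hu, he, hΦ⟩ := exists_below_kestenStigum hk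
  have : Nonempty (Fin k) := ⟨⟨0, hk0⟩⟩
  have hest : ∀ (n : ℕ) (g : VPair n → Bool), ∃ y₀ : Fin n → Fin k, ∀ y : Fin n → Fin k,
      (∑ x : Fin n → Fin k, if 1 / (k : ℝ) + δ ≤ agreement x y then lik (b / n) x g else 0)
        ≤ ∑ x : Fin n → Fin k, if 1 / (k : ℝ) + δ ≤ agreement x y₀ then lik (b / n) x g else 0 :=
    fun n g => Finite.exists_max fun y : Fin n → Fin k =>
      ∑ x : Fin n → Fin k, if 1 / (k : ℝ) + δ ≤ agreement x y then lik (b / n) x g else 0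
  choose est hest using hest
  refine ⟨0, b, le_rfl, hb.le, ?_, δ, hδ, est, ?_⟩
  · have hk1 : (0 : ℝ) < k - 1 := by linarith
    rw [zero_add, div_lt_one (by positivity)]
    nlinarith
  · simp only [zero_div]
    have hlow : Tendsto (fun n : ℕ => 1 - errorBound k n b δ) atTop (nhds 1) := by
      simpa using (tendsto_errorBound hk0 hΦ hδ).const_sub 1
    refine tendsto_of_tendsto_of_tendsto_of_le_of_le' hlow tendsto_const_nhds ?_ ?_
    · filter_upwards [eventually_mul_neg_log_le hb hδ] with n hn
      have hn0 : 0 < n := by exact_mod_cast hb.trans hn.1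
      exact one_sub_errorBound_le hn0 (by omega) hb hn.1 hδ hδ' hn.2 hu he (hest n)
    · filter_upwards [eventually_mul_neg_log_le hb hδ] with n hn
      have hn0 : (0 : ℝ) < n := hb.trans hn.1
      exact sbmProb_le_one hk0 (by positivity) ((div_le_one hn0).2 hn.1.le) _
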